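/- There exists a covering of ℝ^3 by a single self-avoiding curve which is locally isomorphic to every covering Ĉ_R with R a pairing relation satisfying (P). -/

import Mathlib

namespace Folding

noncomputable section

open Set

/-- Points of `ℝ^n` with the euclidean distance. -/
abbrev Pt (n : ℕ) := EuclideanSpace ℝ (Fin n)

/-- `p` is a point of the lattice `ℤ^n`. -/
def latt {n : ℕ} (p : Pt n) : Prop := ∀ i, ∃ m : ℤ, p i = (m : ℝ)

/-- `p` belongs to `m·ℤ^n`. -/
def inLat {n : ℕ} (m : ℕ) (p : Pt n) : Prop := ∀ i, ∃ c : ℤ, p i = (m : ℝ) * (c : ℝ)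

/-- The canonical basis vector `e_i`. -/
def uvec (n : ℕ) (i : Fin n) : Pt n := EuclideanSpace.single i (1 : ℝ)

/-- `u` belongs to `E = {e_1, -e_1, …, e_n, -e_n}`. -/
def IsDir {n : ℕ} (u : Pt n) : Prop := ∃ i, u = uvec n i ∨ u = -uvec n i

/-- A (nonoriented) lattice segment `[x, x + e_i]`, as an unordered pair of endpoints. -/
def IsSeg {n : ℕ} (S : Sym2 (Pt n)) : Prop := ∃ x i, latt x ∧ S = s(x, x + uvec n i)

/-- A curve: a sequence of segments, indexed by an interval of `ℤ` (finite, ℕ-like or ℤ-like),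
recorded through its sequence of vertices; two consecutive segments have exactly one common
endpoint, and the common endpoints with the preceding and the following segments differ
(`noback`). -/
structure Curve (n : ℕ) where
  dom : Set ℤ
  ordConn : dom.OrdConnected
  nontriv : ∃ i, i ∈ dom ∧ i + 1 ∈ dom
  v : ℤ → Pt n
  lattice : ∀ i ∈ dom, latt (v i)
  step : ∀ i : ℤ, i ∈ dom → i + 1 ∈ dom →
    ∃ j, v (i + 1) = v i + uvec n j ∨ v (i + 1) = v i - uvec n j
  noback : ∀ i : ℤ, i - 1 ∈ dom → i + 1 ∈ dom → v (i + 1) ≠ v (i - 1)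

namespace Curve

variable {n : ℕ} (c : Curve n)

/-- The segments of a curve. -/
def segs : Set (Sym2 (Pt n)) :=
  {S | ∃ i : ℤ, i ∈ c.dom ∧ i + 1 ∈ c.dom ∧ S = s(c.v i, c.v (i + 1))}

/-- The connexions between segments of a curve: pairs of consecutive segments. -/
def conn (S T : Sym2 (Pt n)) : Prop :=
  ∃ i : ℤ, i - 1 ∈ c.dom ∧ i + 1 ∈ c.dom ∧
    ((S = s(c.v (i - 1), c.v i) ∧ T = s(c.v i, c.v (i + 1))) ∨
     (T = s(c.v (i - 1), c.v i) ∧ S = s(c.v i, c.v (i + 1))))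

/-- A curve is self-avoiding if each of its segments appears only once. -/
def SelfAvoiding : Prop :=
  ∀ i j : ℤ, i ∈ c.dom → i + 1 ∈ c.dom → j ∈ c.dom → j + 1 ∈ c.dom →
    s(c.v i, c.v (i + 1)) = s(c.v j, c.v (j + 1)) → i = j

/-- A curve without endpoints (indexed by `ℤ`). -/
def NoEndpts : Prop := c.dom = Set.univ

/-- `p` is an endpoint of the curve `c`. -/
def IsEndpt (p : Pt n) : Prop :=
  ∃ i ∈ c.dom, p = c.v i ∧ (i - 1 ∉ c.dom ∨ i + 1 ∉ c.dom)

/-- `S` is the end segment of `c` at its endpoint `p`. -/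
def endSegAt (p : Pt n) (S : Sym2 (Pt n)) : Prop :=
  ∃ i : ℤ, i ∈ c.dom ∧ p = c.v i ∧
    ((i - 1 ∉ c.dom ∧ i + 1 ∈ c.dom ∧ S = s(c.v i, c.v (i + 1))) ∨
     (i + 1 ∉ c.dom ∧ i - 1 ∈ c.dom ∧ S = s(c.v (i - 1), c.v i)))

/-- The number of segments (length) of a curve. -/
def nsegs : ℕ := {i : ℤ | i ∈ c.dom ∧ i + 1 ∈ c.dom}.ncard

end Curve

/-- The trace of a set of curves: its set of segments together with the connexion
relation between segments.  Two sets of curves are geometrically the same set of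
(nonoriented) curves iff they have the same trace. -/
structure Trace (n : ℕ) where
  segs : Set (Sym2 (Pt n))
  conn : Sym2 (Pt n) → Sym2 (Pt n) → Prop

def curveTrace {n : ℕ} (c : Curve n) : Trace n := ⟨c.segs, c.conn⟩

def traceOf {n : ℕ} (E : Set (Curve n)) : Trace n :=
  ⟨{S | ∃ c ∈ E, S ∈ c.segs}, fun S T => ∃ c ∈ E, c.conn S T⟩

/-- Two curves are the same nonoriented curve. -/
def SameCurve {n : ℕ} (c d : Curve n) : Prop := c.segs = d.segs ∧ c.conn = d.conn

/-- A set of pairwise disjoint self-avoiding curves. -/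
def DisjSA {n : ℕ} (E : Set (Curve n)) : Prop :=
  (∀ c ∈ E, c.SelfAvoiding) ∧
  ∀ c ∈ E, ∀ d ∈ E, ¬ SameCurve c d → ∀ S, S ∈ c.segs → S ∉ d.segs

/-- The set of points of `ℝ^n` lying on the segment `S`. -/
def segPts {n : ℕ} (S : Sym2 (Pt n)) : Set (Pt n) :=
  {p | ∃ a b, S = s(a, b) ∧ ∃ t : ℝ, 0 ≤ t ∧ t ≤ 1 ∧ p = a + t • (b - a)}

def Trace.pts {n : ℕ} (T : Trace n) : Set (Pt n) := ⋃ S ∈ T.segs, segPts S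

/-- A set of curves covers `X ⊆ ℝ^n`: each lattice segment containing a point of `X`
appears in one and only one of the curves. -/
def Covers {n : ℕ} (E : Set (Curve n)) (X : Set (Pt n)) : Prop :=
  ∀ S, IsSeg S → (segPts S ∩ X).Nonempty →
    (∃ c ∈ E, S ∈ c.segs) ∧ ∀ c ∈ E, ∀ d ∈ E, S ∈ c.segs → S ∈ d.segs → SameCurve c d

/-- A covering of `ℝ^n` by disjoint self-avoiding curves. -/
def IsCovering {n : ℕ} (E : Set (Curve n)) : Prop := DisjSA E ∧ Covers E Set.univ

/-- A single curve covers `X`. -/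
def CurveCovers {n : ℕ} (c : Curve n) (X : Set (Pt n)) : Prop :=
  ∀ S, IsSeg S → (segPts S ∩ X).Nonempty → S ∈ c.segs

/-- `b` is a curve contained in the curve `a`. -/
def SubCurve {n : ℕ} (b a : Curve n) : Prop :=
  b.segs ⊆ a.segs ∧ ∀ S T, b.conn S T → a.conn S T

/-- The relation `≺` at the level of traces. -/
def TPrec {n : ℕ} (T T' : Trace n) : Prop :=
  T.segs ⊆ T'.segs ∧ ∀ S S', T.conn S S' → T'.conn S S'

/-- `E ≺ F` : each segment of a curve of `E` is a segment of a curve of `F` and each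
connexion between two segments of a curve of `E` also exists in `F`. -/
def Prec {n : ℕ} (E F : Set (Curve n)) : Prop := TPrec (traceOf E) (traceOf F)

/-- Image of a trace under a map of `ℝ^n`. -/
def Trace.map {n : ℕ} (f : Pt n → Pt n) (T : Trace n) : Trace n :=
  ⟨Sym2.map f '' T.segs,
   fun S S' => ∃ A B, T.conn A B ∧ S = Sym2.map f A ∧ S' = Sym2.map f B⟩

/-- Translation of a trace by the vector `t`. -/
def Trace.transl {n : ℕ} (t : Pt n) (T : Trace n) : Trace n := T.map (fun p => p + t)

/-- Property (H) for the pair `(k, l)`. -/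
def SatH {n : ℕ} (A : Set (Curve n)) (k l : ℕ) : Prop :=
  0 < k ∧ 0 < l ∧ k ∣ l ∧ IsCovering A ∧
  (∀ c ∈ A, c.dom.Finite ∧ ∃ x i, latt x ∧ inLat k x ∧ c.IsEndpt x ∧
      c.IsEndpt (x + (k : ℝ) • uvec n i) ∧
      ∀ p, c.IsEndpt p → p = x ∨ p = x + (k : ℝ) • uvec n i) ∧
  (∀ (x : Pt n) (i : Fin n), latt x → inLat k x →
      (∃ c ∈ A, c.IsEndpt x ∧ c.IsEndpt (x + (k : ℝ) • uvec n i)) ∧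
      ∀ c ∈ A, ∀ d ∈ A, c.IsEndpt x → c.IsEndpt (x + (k : ℝ) • uvec n i) →
        d.IsEndpt x → d.IsEndpt (x + (k : ℝ) • uvec n i) → SameCurve c d) ∧
  (∀ t : Pt n, inLat l t → Trace.transl t (traceOf A) = traceOf A)

/-- The trace of the convolution product `A ∗ B`, where `A` satisfies (H) for `(k, l)`:
apply to `B` the homothety of center `0` and ratio `k`, then replace each resulting
segment by the curve of `A` having the same endpoints (connexions come from the curves
of `A`, together with the junctions of the end segments of consecutive `A`-curves). -/
def ConvTrace {n : ℕ} (k : ℕ) (A B : Set (Curve n)) : Trace n where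
  segs := {S | ∃ a b : Pt n, s(a, b) ∈ (traceOf B).segs ∧
    ∃ c ∈ A, c.IsEndpt ((k : ℝ) • a) ∧ c.IsEndpt ((k : ℝ) • b) ∧ S ∈ c.segs}
  conn := fun S S' =>
    (∃ a b : Pt n, s(a, b) ∈ (traceOf B).segs ∧
      ∃ c ∈ A, c.IsEndpt ((k : ℝ) • a) ∧ c.IsEndpt ((k : ℝ) • b) ∧ c.conn S S') ∨
    (∃ a b d : Pt n, (traceOf B).conn s(a, b) s(b, d) ∧
      ∃ c ∈ A, ∃ c' ∈ A, c.IsEndpt ((k : ℝ) • a) ∧ c.IsEndpt ((k : ℝ) • b) ∧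
        c'.IsEndpt ((k : ℝ) • b) ∧ c'.IsEndpt ((k : ℝ) • d) ∧
        ((c.endSegAt ((k : ℝ) • b) S ∧ c'.endSegAt ((k : ℝ) • b) S') ∨
         (c.endSegAt ((k : ℝ) • b) S' ∧ c'.endSegAt ((k : ℝ) • b) S)))

/-- The two-sided identity of the convolution product: the covering consisting of all
curves with one segment. -/
def unitTrace (n : ℕ) : Trace n := ⟨{S | IsSeg S}, fun _ _ => False⟩

/-- `P s` realizes the power `A^s` for the convolution product. -/
def PowersOf {n : ℕ} (A : Set (Curve n)) (k : ℕ) (P : ℕ → Set (Curve n)) : Prop :=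
  (∀ s, DisjSA (P s)) ∧ traceOf (P 0) = unitTrace n ∧
  ∀ s, traceOf (P (s + 1)) = ConvTrace k A (P s)

/-- The trace of `Â`, the inductive limit of the `A^s` for `≺`. -/
def hatTrace {n : ℕ} (P : ℕ → Set (Curve n)) : Trace n :=
  ⟨{S | ∃ s, S ∈ (traceOf (P s)).segs}, fun S T => ∃ s, (traceOf (P s)).conn S T⟩

/-- A pairing relation on `E = {e_1, -e_1, …, e_n, -e_n}`. -/
def IsPairing {n : ℕ} (R : Pt n → Pt n → Prop) : Prop :=
  (∀ u v, R u v → R v u) ∧ (∀ u v, R u v → IsDir u ∧ IsDir v) ∧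
  (∀ u, ¬ R u u) ∧ ∀ u, IsDir u → ∃! v, R u v

/-- The trace of `Â_R` : `Â` with the segments with endpoint `0` connected according
to `R`. -/
def hatRTrace {n : ℕ} (P : ℕ → Set (Curve n)) (R : Pt n → Pt n → Prop) : Trace n :=
  ⟨(hatTrace P).segs,
   fun S T => (hatTrace P).conn S T ∨
     ∃ u v, R u v ∧ S = s((0 : Pt n), u) ∧ T = s((0 : Pt n), v)⟩

/-- The cube `P_{x,h}`. -/
def cube {n : ℕ} (x : Pt n) (h : ℕ) : Set (Pt n) :=
  {p | ∀ i, x i - h ≤ p i ∧ p i ≤ x i + h}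

/-- Restriction of a trace to a region `X` of `ℝ^n`. -/
def Trace.restr {n : ℕ} (T : Trace n) (X : Set (Pt n)) : Trace n :=
  ⟨{S | S ∈ T.segs ∧ segPts S ⊆ X},
   fun S S' => T.conn S S' ∧ segPts S ⊆ X ∧ segPts S' ⊆ X⟩

/-- Condition (C). -/
def CondC {n : ℕ} (T : Trace n) : Prop :=
  ∀ (x : Pt n) (h : ℕ), latt x → 1 ≤ h →
    ∃ y : Pt n, latt y ∧ y ∉ cube x h ∧
      Trace.transl (y - x) (T.restr (cube x h)) = T.restr (cube y h)

/-- `(B(x,r) ∩ T, x) ≅ (B(y,r) ∩ T', y)` : the translation sending `x` to `y` maps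
the part of `T` in the closed ball `B(x,r)` onto the part of `T'` in `B(y,r)`,
preserving the connexions between segments. -/
def BallIso {n : ℕ} (T : Trace n) (x : Pt n) (T' : Trace n) (y : Pt n) (r : ℝ) : Prop :=
  (fun p => p + (y - x)) '' (T.pts ∩ Metric.closedBall x r) =
      T'.pts ∩ Metric.closedBall y r ∧
  (∀ S S', T.conn S S' → segPts S ⊆ Metric.closedBall x r →
      segPts S' ⊆ Metric.closedBall x r →
      T'.conn (Sym2.map (fun p => p + (y - x)) S) (Sym2.map (fun p => p + (y - x)) S')) ∧
  (∀ S S', T'.conn S S' → segPts S ⊆ Metric.closedBall y r →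
      segPts S' ⊆ Metric.closedBall y r →
      T.conn (Sym2.map (fun p => p + (x - y)) S) (Sym2.map (fun p => p + (x - y)) S'))

/-- The local isomorphism property. -/
def LocIsoProp {n : ℕ} (T : Trace n) : Prop :=
  ∀ (x : Pt n) (r : ℝ), 0 ≤ r →
    ∃ t : ℝ, 0 ≤ t ∧ ∀ y : Pt n, ∃ z ∈ Metric.closedBall y t, BallIso T x T z r

/-- Two traces are locally isomorphic. -/
def LocallyIso {n : ℕ} (T T' : Trace n) : Prop :=
  (∀ (x : Pt n) (r : ℝ), 0 ≤ r → ∃ y, BallIso T x T' y r) ∧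
  (∀ (y : Pt n) (r : ℝ), 0 ≤ r → ∃ x, BallIso T' y T x r)

/-- `Ω_{s,x}` : suppress the connexions between segments whose common endpoint lies in
`x + k^s ℤ^n`. -/
def OmegaTrace {n : ℕ} (k s : ℕ) (x : Pt n) (T : Trace n) : Trace n :=
  ⟨T.segs, fun S S' => T.conn S S' ∧ ¬ ∃ p, p ∈ S ∧ p ∈ S' ∧ inLat (k ^ s) (p - x)⟩

/-- `Σ_{s,x}(E)` : for each curve `D` of `E` passing through `x`, the curve(s) with
endpoint `x` contained in `D` having maximal length, this length being limited to
`8^s`. -/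
def SigmaSet {n : ℕ} (s : ℕ) (x : Pt n) (E : Set (Curve n)) : Set (Curve n) :=
  {b | ∃ D ∈ E, SubCurve b D ∧ b.IsEndpt x ∧ b.nsegs ≤ 8 ^ s ∧
    ∀ b' : Curve n, SubCurve b' D → b'.IsEndpt x → b'.nsegs ≤ 8 ^ s →
      SubCurve b b' → SameCurve b b'}

/-- A positive (orientation preserving) isometry of `ℝ^n`. -/
def PosIsom {n : ℕ} (f : Pt n → Pt n) : Prop :=
  ∃ (g : Pt n ≃ₗᵢ[ℝ] Pt n) (t : Pt n), (∀ x, f x = g x + t) ∧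
    0 < LinearMap.det (g.toLinearEquiv.toLinearMap)

/-- `E` consists of exactly `m` curves. -/
def HasExactly {n : ℕ} (E : Set (Curve n)) (m : ℕ) : Prop :=
  ∃ L : List (Curve n), L.length = m ∧ (∀ c ∈ L, c ∈ E) ∧
    L.Pairwise (fun c d => ¬ SameCurve c d) ∧ ∀ c ∈ E, ∃ d ∈ L, SameCurve c d

/-- `E` consists of at most `m` curves. -/
def AtMost {n : ℕ} (E : Set (Curve n)) (m : ℕ) : Prop :=
  ∃ L : List (Curve n), L.length ≤ m ∧ ∀ c ∈ E, ∃ d ∈ L, SameCurve c d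

/-- The set of points of a curve. -/
def curvePts {n : ℕ} (c : Curve n) : Set (Pt n) := ⋃ S ∈ c.segs, segPts S

-- ℝ³-specific part
def toPt3 (f : Fin 3 → ℝ) : Pt 3 := (WithLp.equiv 2 (Fin 3 → ℝ)).symm f

def p3 (a b c : ℤ) : Pt 3 := toPt3 ![(a : ℝ), (b : ℝ), (c : ℝ)]

/-- The vertices of the curve `C`. -/
def CList : List (Pt 3) :=
  [p3 0 0 0, p3 0 (-1) 0, p3 0 (-1) (-1), p3 0 0 (-1), p3 1 0 (-1),
   p3 1 (-1) (-1), p3 1 (-1) 0, p3 1 0 0, p3 2 0 0]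

/-- The block `ℬ₀` : six curves given by their lists of successive vertices. -/
def B0 : List (List (Pt 3)) :=
  [ CList,
    [p3 0 0 0, p3 0 0 1, p3 0 1 1, p3 0 1 0, p3 (-1) 1 0, p3 (-1) 1 1,
     p3 (-1) 0 1, p3 (-1) 0 0, p3 (-2) 0 0],
    [p3 0 0 0, p3 0 0 (-1), p3 (-1) 0 (-1), p3 (-1) 0 0, p3 (-1) 1 0,
     p3 (-1) 1 (-1), p3 0 1 (-1), p3 0 1 0, p3 0 2 0],
    [p3 0 0 0, p3 1 0 0, p3 1 0 1, p3 0 0 1, p3 0 (-1) 1, p3 1 (-1) 1,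
     p3 1 (-1) 0, p3 0 (-1) 0, p3 0 (-2) 0],
    [p3 0 0 0, p3 (-1) 0 0, p3 (-1) (-1) 0, p3 0 (-1) 0, p3 0 (-1) 1,
     p3 (-1) (-1) 1, p3 (-1) 0 1, p3 0 0 1, p3 0 0 2],
    [p3 0 0 0, p3 0 1 0, p3 1 1 0, p3 1 0 0, p3 1 0 (-1), p3 1 1 (-1),
     p3 0 1 (-1), p3 0 0 (-1), p3 0 0 (-2)] ]

def sigma3 : Pt 3 → Pt 3 := fun x => toPt3 ![x 0, -(x 1), -(x 2)]
def tau3 : Pt 3 → Pt 3 := fun x => toPt3 ![x 0, x 2, -(x 1)]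
def ups3 : Pt 3 → Pt 3 := fun x => toPt3 ![x 0, -(x 2), x 1]

/-- The four blocks `ℬ₀, ℬ₁, ℬ₂, ℬ₃`. -/
def blockLists : Fin 4 → List (List (Pt 3)) :=
  ![B0,
    B0.map (List.map fun p => p3 2 2 0 + sigma3 p),
    B0.map (List.map fun p => p3 2 0 2 + tau3 p),
    B0.map (List.map fun p => p3 0 2 2 + ups3 p)]

def listSegs (L : List (Pt 3)) : Set (Sym2 (Pt 3)) :=
  {S | ∃ j : ℕ, j + 1 < L.length ∧ S = s(L.getD j 0, L.getD (j + 1) 0)}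

def listConn (L : List (Pt 3)) (S T : Sym2 (Pt 3)) : Prop :=
  ∃ j : ℕ, j + 2 < L.length ∧
    ((S = s(L.getD j 0, L.getD (j + 1) 0) ∧ T = s(L.getD (j + 1) 0, L.getD (j + 2) 0)) ∨
     (T = s(L.getD j 0, L.getD (j + 1) 0) ∧ S = s(L.getD (j + 1) 0, L.getD (j + 2) 0)))

/-- The trace of the curve given by a list of successive vertices. -/
def listTrace (L : List (Pt 3)) : Trace 3 := ⟨listSegs L, listConn L⟩

/-- The trace of the covering `𝒞 = ⋃_{u ∈ ℤ³, 0 ≤ i ≤ 3} (4u + ℬ_i)`. -/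
def CTrace : Trace 3 where
  segs := {S | ∃ u : Pt 3, latt u ∧ ∃ (i : Fin 4), ∃ M ∈ blockLists i,
    S ∈ (Trace.transl ((4 : ℝ) • u) (listTrace M)).segs}
  conn := fun S T => ∃ u : Pt 3, latt u ∧ ∃ (i : Fin 4), ∃ M ∈ blockLists i,
    (Trace.transl ((4 : ℝ) • u) (listTrace M)).conn S T

open Classical in
/-- The permutation `θ` of `E` with `θ(e₁) = -e₂`, `θ(e₂) = -e₃`, `θ(e₃) = -e₁`
and `θ² = Id`. -/
def theta3 : Pt 3 → Pt 3 := fun u =>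
  if u = uvec 3 0 then -uvec 3 1
  else if u = -uvec 3 1 then uvec 3 0
  else if u = uvec 3 1 then -uvec 3 2
  else if u = -uvec 3 2 then uvec 3 1
  else if u = uvec 3 2 then -uvec 3 0
  else if u = -uvec 3 0 then uvec 3 2
  else u

/-- `R^θ`. -/
def Rtheta (R : Pt 3 → Pt 3 → Prop) : Pt 3 → Pt 3 → Prop :=
  fun u v => R (theta3 u) (theta3 v)

def Rx (P : ℕ → Set (Curve 3)) (x : Pt 3) : Pt 3 → Pt 3 → Prop :=
  fun u v => (hatTrace P).conn s(x, x + u) s(x, x + v)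

/-- Condition (P). -/
def SatP (P : ℕ → Set (Curve 3)) (R : Pt 3 → Pt 3 → Prop) : Prop :=
  ∃ x : Pt 3, (∀ i, x i = -2 ∨ x i = 0 ∨ x i = 2 ∨ x i = 4) ∧
    (¬ ∀ i, x i = 0 ∨ x i = 4) ∧ (Rx P x = R ∨ Rx P x = Rtheta R)

/-- The trace of `Ĉ_X`, the inductive limit of the sets `x_s + 𝒞^s`. -/
def hatXTrace (P : ℕ → Set (Curve 3)) (x : ℕ → Pt 3) : Trace 3 :=
  ⟨{S | ∃ s, 1 ≤ s ∧ S ∈ (Trace.transl (x s) (traceOf (P s))).segs},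
   fun S T => ∃ s, 1 ≤ s ∧ (Trace.transl (x s) (traceOf (P s))).conn S T⟩

/-- The curve `c` is equivalent to `C` (image of `C` by a positive isometry). -/
def EquivToC (c : Curve 3) : Prop :=
  ∃ f, PosIsom f ∧ curveTrace c = Trace.map f (listTrace CList)

/-- `x` is an endpoint of type `0` (resp. `1`) of the curve `c`, for `c`
equivalent to `C`. -/
def EndptType (c : Curve 3) (x : Pt 3) (ty : ℕ) : Prop :=
  ∃ f, PosIsom f ∧ curveTrace c = Trace.map f (listTrace CList) ∧
    x = f (if ty = 0 then p3 0 0 0 else p3 2 0 0)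

/-! ### Combinatorial model of the covering on `ℤ³` -/

/-- Integer points of `ℝ³`. -/
abbrev Z3 := ℤ × ℤ × ℤ

/-- The six directions `e₁, -e₁, e₂, -e₂, e₃, -e₃`. -/
def dir : Fin 6 → Z3
  | 0 => (1, 0, 0)
  | 1 => (-1, 0, 0)
  | 2 => (0, 1, 0)
  | 3 => (0, -1, 0)
  | 4 => (0, 0, 1)
  | 5 => (0, 0, -1)

/-- The opposite direction. -/
def opp : Fin 6 → Fin 6
  | 0 => 1
  | 1 => 0
  | 2 => 3
  | 3 => 2
  | 4 => 5
  | 5 => 4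

lemma dir_opp (d : Fin 6) : dir (opp d) = -dir d := by revert d; decide

@[simp] lemma opp_opp (d : Fin 6) : opp (opp d) = d := by revert d; decide

lemma dir_injective : Function.Injective dir := by decide

lemma add_dir_opp (p : Z3) (d : Fin 6) : p + dir d + dir (opp d) = p := by
  rw [dir_opp]; abel

/-- Reduction of the coordinates modulo `4`. -/
def red (p : Z3) : Z3 := (p.1 % 4, p.2.1 % 4, p.2.2 % 4)

/-- `p` belongs to `2ℤ³`. -/
def IsEven (p : Z3) : Prop := p.1 % 2 = 0 ∧ p.2.1 % 2 = 0 ∧ p.2.2 % 2 = 0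

instance (p : Z3) : Decidable (IsEven p) := inferInstanceAs (Decidable (_ ∧ _))

def half (p : Z3) : Z3 := (p.1 / 2, p.2.1 / 2, p.2.2 / 2)

/-- The local structure of `𝒞`, as an involution of the directions at each point.  If `p` is not
in `2ℤ³`, then `𝒞` connects `[p, p + dir d]` and `[p, p + dir (tab p d)]`; if `p ∈ 2ℤ³`, then the
curve from `p` to `p + 2 * dir d` starts with `[p, p + dir (tab p d)]`.  The values for the 64
classes modulo `4` are stored as base `8` digits. -/
def tab (p : Z3) (d : Fin 6) : Fin 6 :=
  Fin.ofNat 6 ((16331802429270721735212378369176639583464635655388757021403100578527077829054523369132779047071896005809887776120656199910938027136463705095451588864733205789427900833267702525334293689007620583195452296847746024240916325760150037381764459950042018635575677442689278094998651012375705253095176372635699839138510966421314390842926056321724963426659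
    >>> (3 * (6 * ((p.1 % 4).toNat + 4 * (p.2.1 % 4).toNat + 16 * (p.2.2 % 4).toNat) + d.val))) % 8)

lemma red_red (p : Z3) : red (red p) = red p := by simp [red]

lemma red_add_congr {p q : Z3} (h : red p = red q) (v : Z3) : red (p + v) = red (q + v) := by
  simp only [red, Prod.mk.injEq, Prod.fst_add, Prod.snd_add] at h ⊢
  omega

lemma red_add_four (p t : Z3) : red (p + (4 : ℤ) • t) = red p := by
  simp only [red, Prod.mk.injEq, Prod.fst_add, Prod.snd_add, Prod.smul_fst, Prod.smul_snd,
    smul_eq_mul]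
  omega

lemma exists_eq_red_add (p : Z3) : ∃ t : Z3, p = red p + (4 : ℤ) • t := by
  refine ⟨(p.1 / 4, p.2.1 / 4, p.2.2 / 4), ?_⟩
  ext <;> simp [red] <;> omega

lemma tab_congr {p q : Z3} (h : red p = red q) : tab p = tab q := by
  simp only [red, Prod.mk.injEq] at h
  funext d
  simp only [tab, h]

lemma tab_red (p : Z3) : tab (red p) = tab p := tab_congr (red_red p)

lemma isEven_congr {p q : Z3} (h : red p = red q) : IsEven p ↔ IsEven q := by
  simp only [red, Prod.mk.injEq] at h
  simp only [IsEven]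
  omega

lemma isEven_red (p : Z3) : IsEven (red p) ↔ IsEven p := isEven_congr (red_red p)

lemma isEven_two_smul (q : Z3) : IsEven ((2 : ℤ) • q) := by
  simp [IsEven]

lemma half_two_smul (q : Z3) : half ((2 : ℤ) • q) = q := by
  simp [half]

lemma IsEven.eq_two_smul {p : Z3} (h : IsEven p) : p = (2 : ℤ) • half p := by
  simp only [IsEven] at h
  ext <;> simp [half] <;> omega

lemma IsEven.add {p q : Z3} (hp : IsEven p) (hq : IsEven q) : IsEven (p + q) := by
  simp only [IsEven, Prod.fst_add, Prod.snd_add] at *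
  omega

lemma IsEven.sub {p q : Z3} (hp : IsEven p) (hq : IsEven q) : IsEven (p - q) := by
  simp only [IsEven, Prod.fst_sub, Prod.snd_sub] at *
  omega

lemma two_smul_injective : Function.Injective (fun q : Z3 => (2 : ℤ) • q) := fun p q h => by
  rw [← half_two_smul p, ← half_two_smul q]
  exact congrArg half h

/-- A property of residues modulo `4` is checked on representatives. -/
lemma forall_red {Q : Z3 → Prop} (h : ∀ a b c : Fin 4, Q ((a.val : ℤ), (b.val : ℤ), (c.val : ℤ)))
    (p : Z3) : Q (red p) := by
  have := h ⟨(p.1 % 4).toNat, by omega⟩ ⟨(p.2.1 % 4).toNat, by omega⟩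
    ⟨(p.2.2 % 4).toNat, by omega⟩
  have h1 : ((p.1 % 4).toNat : ℤ) = p.1 % 4 := by omega
  have h2 : ((p.2.1 % 4).toNat : ℤ) = p.2.1 % 4 := by omega
  have h3 : ((p.2.2 % 4).toNat : ℤ) = p.2.2 % 4 := by omega
  rwa [h1, h2, h3] at this

lemma tab_tab (p : Z3) (d : Fin 6) : tab p (tab p d) = d := by
  rw [← tab_red p]
  revert d
  exact forall_red (Q := fun p => ∀ d, tab p (tab p d) = d) (by decide +kernel) p

lemma tab_ne {p : Z3} (hp : ¬ IsEven p) (d : Fin 6) : tab p d ≠ d := by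
  rw [← tab_red p]
  rw [← isEven_red] at hp
  revert hp d
  exact forall_red (Q := fun p => ¬ IsEven p → ∀ d, tab p d ≠ d) (by decide +kernel) p

/-! ### Connexions in the powers of `𝒞` -/

/-- The connexions of `𝒞^s`: `[p, p + dir d]` is connected with `[p, p + dir (connPow s p d)]`,
unless `connPow s p d = d`, which means that `[p, p + dir d]` is an end segment at `p`. -/
def connPow : ℕ → Z3 → Fin 6 → Fin 6
  | 0, _, d => d
  | s + 1, p, d => if IsEven p then tab p (connPow s (half p) (tab p d)) else tab p d

lemma connPow_two_smul (s : ℕ) (q : Z3) (d : Fin 6) :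
    connPow (s + 1) ((2 : ℤ) • q) d =
      tab ((2 : ℤ) • q) (connPow s q (tab ((2 : ℤ) • q) d)) := by
  rw [connPow, if_pos (isEven_two_smul q), half_two_smul]

lemma connPow_of_not_isEven (s : ℕ) {p : Z3} (hp : ¬ IsEven p) (d : Fin 6) :
    connPow (s + 1) p d = tab p d := by
  rw [connPow, if_neg hp]

lemma connPow_connPow (s : ℕ) (p : Z3) (d : Fin 6) : connPow s p (connPow s p d) = d := by
  induction s generalizing p d with
  | zero => rfl
  | succ s ih =>
    simp only [connPow]
    split_ifs
    · rw [tab_tab, ih, tab_tab]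
    · exact tab_tab p d

lemma connPow_periodic (s : ℕ) (p t : Z3) (d : Fin 6) :
    connPow s (p + (2 ^ (s + 1) : ℤ) • t) d = connPow s p d := by
  induction s generalizing p t d with
  | zero => rfl
  | succ s ih =>
    have hred : red (p + (2 ^ (s + 1 + 1) : ℤ) • t) = red p := by
      rw [show (2 ^ (s + 1 + 1) : ℤ) • t = (4 : ℤ) • (2 ^ s : ℤ) • t by
        rw [smul_smul]; congr 1; ring]
      exact red_add_four _ _
    by_cases hp : IsEven p
    · obtain ⟨q, rfl⟩ : ∃ q, p = (2 : ℤ) • q := ⟨_, hp.eq_two_smul⟩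
      have e : (2 : ℤ) • q + (2 ^ (s + 1 + 1) : ℤ) • t
          = (2 : ℤ) • (q + (2 ^ (s + 1) : ℤ) • t) := by
        rw [smul_add, smul_smul]; congr 2; ring
      rw [e] at hred ⊢
      rw [connPow_two_smul, connPow_two_smul, ih, tab_congr hred]
    · have hp' := hp
      rw [← isEven_congr hred] at hp'
      rw [connPow_of_not_isEven _ hp, connPow_of_not_isEven _ hp', tab_congr hred]

lemma connPow_succ_eq {s : ℕ} {p : Z3} {d : Fin 6} (h : connPow s p d ≠ d) :
    connPow (s + 1) p d = connPow s p d := by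
  induction s generalizing p d with
  | zero => exact absurd rfl h
  | succ s ih =>
    by_cases hp : IsEven p
    · have e (n : ℕ) : connPow (n + 1) p d = tab p (connPow n (half p) (tab p d)) := if_pos hp
      rw [e] at h
      rw [e, e, ih]
      intro h'
      rw [h', tab_tab] at h
      exact h rfl
    · rw [connPow_of_not_isEven _ hp, connPow_of_not_isEven _ hp]

lemma connPow_eq_of_le {s s' : ℕ} (hs : s ≤ s') {p : Z3} {d : Fin 6} (h : connPow s p d ≠ d) :
    connPow s' p d = connPow s p d := by
  induction s', hs using Nat.le_induction with
  | base => rfl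
  | succ n _ ih => rw [connPow_succ_eq (by rwa [ih]), ih]

lemma connPow_eq_connPow {s s' : ℕ} {p : Z3} {d : Fin 6} (h : connPow s p d ≠ d)
    (h' : connPow s' p d ≠ d) : connPow s p d = connPow s' p d := by
  rcases le_total s s' with hs | hs
  · exact (connPow_eq_of_le hs h).symm
  · exact connPow_eq_of_le hs h'

lemma connPow_zero (s : ℕ) (d : Fin 6) : connPow s 0 d = d := by
  induction s generalizing d with
  | zero => rfl
  | succ s ih =>
    have := connPow_two_smul s 0 d
    rwa [smul_zero, ih, tab_tab] at this

/-- Only the points of `2^s ℤ³` have no connexions in `𝒞^s`. -/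
lemma exists_smul_of_connPow_eq {s : ℕ} {p : Z3} {d : Fin 6} (h : connPow s p d = d) :
    ∃ q : Z3, p = (2 ^ s : ℤ) • q := by
  induction s generalizing p d with
  | zero => exact ⟨p, by simp⟩
  | succ s ih =>
    by_cases hp : IsEven p
    · obtain ⟨r, rfl⟩ : ∃ q, p = (2 : ℤ) • q := ⟨_, hp.eq_two_smul⟩
      rw [connPow_two_smul] at h
      obtain ⟨q, rfl⟩ := ih (p := r) (d := tab ((2 : ℤ) • r) d) (by
        conv_rhs => rw [← h, tab_tab])
      exact ⟨q, by rw [smul_smul]; congr 1; ring⟩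
    · rw [connPow_of_not_isEven _ hp] at h
      exact absurd h (tab_ne hp d)

/-! ### Position of a segment in the curve of `𝒞` which contains it -/

/-- For the oriented segment from `y` to `y + dir d`, `posn 8 y d = (o, U, k)` means that this
segment is the segment of index `k` in the curve of `𝒞` from `y + o` to `y + o + 2 * dir U`.
The first argument bounds the number of backward steps in the computation. -/
def posn : ℕ → Z3 → Fin 6 → Z3 × Fin 6 × ℕ
  | 0, _, d => (0, d, 0)
  | n + 1, y, d =>
    if IsEven y then (0, tab y d, 0)
    else
      match posn n (y + dir (tab y d)) (opp (tab y d)) with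
      | (o, U, k) => (o + dir (tab y d), U, k + 1)

lemma posn_congr (n : ℕ) {y y' : Z3} (h : red y = red y') (d : Fin 6) :
    posn n y d = posn n y' d := by
  induction n generalizing y y' d with
  | zero => rfl
  | succ n ih =>
    simp only [posn, isEven_congr h, tab_congr h, ih (red_add_congr h _)]

lemma posn_of_isEven {y : Z3} (hy : IsEven y) (d : Fin 6) : posn 8 y d = (0, tab y d, 0) := by
  rw [posn, if_pos hy]

lemma posn_of_not_isEven {y : Z3} (hy : ¬ IsEven y) (d : Fin 6) :
    (posn 8 y d).1 = (posn 8 (y + dir (tab y d)) (opp (tab y d))).1 + dir (tab y d) ∧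
    (posn 8 y d).2.1 = (posn 8 (y + dir (tab y d)) (opp (tab y d))).2.1 ∧
    (posn 8 y d).2.2 = (posn 8 (y + dir (tab y d)) (opp (tab y d))).2.2 + 1 := by
  rw [← posn_congr 8 (red_red y), ← tab_red y,
    ← posn_congr 8 (red_add_congr (red_red y) _)]
  rw [← isEven_red] at hy
  revert hy d
  exact forall_red (Q := fun y => ¬ IsEven y → ∀ d,
    (posn 8 y d).1 = (posn 8 (y + dir (tab y d)) (opp (tab y d))).1 + dir (tab y d) ∧
    (posn 8 y d).2.1 = (posn 8 (y + dir (tab y d)) (opp (tab y d))).2.1 ∧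
    (posn 8 y d).2.2 = (posn 8 (y + dir (tab y d)) (opp (tab y d))).2.2 + 1)
    (by decide +kernel) y

lemma posn_bounds (y : Z3) (d : Fin 6) :
    IsEven (y + (posn 8 y d).1) ∧ (posn 8 y d).2.2 < 8 ∧
    (-2 ≤ (posn 8 y d).1.1 ∧ (posn 8 y d).1.1 ≤ 2) ∧
    (-2 ≤ (posn 8 y d).1.2.1 ∧ (posn 8 y d).1.2.1 ≤ 2) ∧
    -2 ≤ (posn 8 y d).1.2.2 ∧ (posn 8 y d).1.2.2 ≤ 2 := by
  rw [← posn_congr 8 (red_red y), ← isEven_congr (red_add_congr (red_red y) _)]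
  revert d
  exact forall_red (Q := fun y => ∀ d,
    IsEven (y + (posn 8 y d).1) ∧ (posn 8 y d).2.2 < 8 ∧
    (-2 ≤ (posn 8 y d).1.1 ∧ (posn 8 y d).1.1 ≤ 2) ∧
    (-2 ≤ (posn 8 y d).1.2.1 ∧ (posn 8 y d).1.2.1 ≤ 2) ∧
    -2 ≤ (posn 8 y d).1.2.2 ∧ (posn 8 y d).1.2.2 ≤ 2) (by decide +kernel) y

lemma posn_last {y : Z3} {d : Fin 6} (h : IsEven (y + dir d)) :
    (posn 8 y d).2.2 = 7 ∧ dir d = (posn 8 y d).1 + (2 : ℤ) • dir (posn 8 y d).2.1 ∧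
    tab (y + dir d) (opp d) = opp (posn 8 y d).2.1 := by
  rw [← posn_congr 8 (red_red y), ← tab_congr (red_add_congr (red_red y) _)]
  rw [← isEven_congr (red_add_congr (red_red y) _)] at h
  exact forall_red (Q := fun y => ∀ d, IsEven (y + dir d) →
    (posn 8 y d).2.2 = 7 ∧ dir d = (posn 8 y d).1 + (2 : ℤ) • dir (posn 8 y d).2.1 ∧
    tab (y + dir d) (opp d) = opp (posn 8 y d).2.1) (by decide +kernel) y d h

lemma posn_reverse (y : Z3) (d : Fin 6) :
    dir d + (posn 8 (y + dir d) (opp d)).1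
      = (posn 8 y d).1 + (2 : ℤ) • dir (posn 8 y d).2.1 ∧
    (posn 8 (y + dir d) (opp d)).2.1 = opp (posn 8 y d).2.1 := by
  rw [← posn_congr 8 (red_red y), ← posn_congr 8 (red_add_congr (red_red y) _)]
  revert d
  exact forall_red (Q := fun y => ∀ d,
    dir d + (posn 8 (y + dir d) (opp d)).1
      = (posn 8 y d).1 + (2 : ℤ) • dir (posn 8 y d).2.1 ∧
    (posn 8 (y + dir d) (opp d)).2.1 = opp (posn 8 y d).2.1) (by decide +kernel) y

/-! ### A limit of translated powers of `𝒞` -/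

/-- The digits, periodic with period `3`, of the `2`-adic translation. -/
def digit (j : ℕ) : Z3 :=
  match j % 3 with
  | 0 => (0, 0, 0)
  | 1 => (0, 1, 1)
  | _ => (0, 0, 1)

/-- `offset j s` is the number whose binary digits are the `s` digits from `j`. -/
def offset : ℕ → ℕ → Z3
  | _, 0 => 0
  | j, s + 1 => digit j + (2 : ℤ) • offset (j + 1) s

lemma offset_succ (j s : ℕ) : offset j (s + 1) = offset j s + (2 ^ s : ℤ) • digit (j + s) := by
  induction s generalizing j with
  | zero => simp [offset]
  | succ s ih =>
    rw [offset, ih (j + 1), offset, show j + 1 + s = j + (s + 1) by omega, pow_succ]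
    module

lemma connPow_offset_succ_eq {j s : ℕ} {p : Z3} {d : Fin 6}
    (h : connPow s (p + offset j (s + 1)) d ≠ d) :
    connPow (s + 1) (p + offset j (s + 2)) d = connPow s (p + offset j (s + 1)) d := by
  have e : connPow s (p + offset j (s + 2)) d = connPow s (p + offset j (s + 1)) d := by
    rw [offset_succ j (s + 1), ← add_assoc, connPow_periodic]
  rw [connPow_succ_eq (by rwa [e]), e]

lemma connPow_offset_eq_of_le {j s s' : ℕ} (hs : s ≤ s') {p : Z3} {d : Fin 6}
    (h : connPow s (p + offset j (s + 1)) d ≠ d) :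
    connPow s' (p + offset j (s' + 1)) d = connPow s (p + offset j (s + 1)) d := by
  induction s', hs using Nat.le_induction with
  | base => rfl
  | succ n _ ih => rw [connPow_offset_succ_eq (by rwa [ih]), ih]

lemma exists_eventually_connPow (j : ℕ) (p : Z3) (d : Fin 6) :
    ∃ e, ∀ᶠ s in Filter.atTop, connPow s (p + offset j (s + 1)) d = e := by
  by_cases h : ∃ s, connPow s (p + offset j (s + 1)) d ≠ d
  · obtain ⟨s, hs⟩ := h
    exact ⟨_, Filter.eventually_atTop.2 ⟨s, fun s' h' => connPow_offset_eq_of_le h' hs⟩⟩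
  · push Not at h
    exact ⟨d, Filter.Eventually.of_forall h⟩

/-- The connexions in the limit of the coverings `𝒞^s - offset j (s + 1)`. -/
def limConn (j : ℕ) (p : Z3) (d : Fin 6) : Fin 6 := (exists_eventually_connPow j p d).choose

lemma limConn_spec (j : ℕ) (p : Z3) (d : Fin 6) :
    ∀ᶠ s in Filter.atTop, connPow s (p + offset j (s + 1)) d = limConn j p d :=
  (exists_eventually_connPow j p d).choose_spec

lemma limConn_eq {j s : ℕ} {p : Z3} {d : Fin 6} (h : connPow s (p + offset j (s + 1)) d ≠ d) :
    limConn j p d = connPow s (p + offset j (s + 1)) d := by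
  obtain ⟨s', h1, h2⟩ := ((limConn_spec j p d).and (Filter.eventually_ge_atTop s)).exists
  rw [← h1, connPow_offset_eq_of_le h2 h]

lemma limConn_limConn (j : ℕ) (p : Z3) (d : Fin 6) : limConn j p (limConn j p d) = d := by
  obtain ⟨s, h1, h2⟩ :=
    ((limConn_spec j p d).and (limConn_spec j p (limConn j p d))).exists
  rw [← h2, ← h1, connPow_connPow]

/-- The position of `p`, up to translations by `4ℤ³`, with respect to `𝒞` in the `j`-th limit. -/
def base (j : ℕ) (p : Z3) : Z3 := p + digit j + (2 : ℤ) • digit (j + 1)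

lemma base_add (j : ℕ) (p v : Z3) : base j (p + v) = base j p + v := by
  simp only [base]; abel

lemma red_add_offset (j s : ℕ) (p : Z3) : red (p + offset j (s + 2)) = red (base j p) := by
  rw [offset, offset, ← red_add_four (base j p) (offset (j + 1 + 1) s)]
  congr 1
  rw [base]
  module

lemma isEven_base_iff (j : ℕ) (p : Z3) : IsEven (base j p) ↔ IsEven (p + digit j) := by
  refine ⟨fun h => ?_, fun h => h.add (isEven_two_smul _)⟩
  simpa [base] using h.sub (isEven_two_smul (digit (j + 1)))

lemma limConn_of_not_isEven {j : ℕ} {p : Z3} (hp : ¬ IsEven (base j p)) (d : Fin 6) :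
    limConn j p d = tab (base j p) d := by
  have e : connPow 1 (p + offset j (1 + 1)) d = tab (base j p) d := by
    have := red_add_offset j 0 p
    rw [connPow_of_not_isEven 0 (by rwa [isEven_congr this]), tab_congr this]
  rw [← e]
  exact limConn_eq (by rw [e]; exact tab_ne hp d)

lemma limConn_of_isEven {j : ℕ} {p : Z3} (hp : IsEven (base j p)) (d : Fin 6) :
    limConn j p d =
      tab (base j p) (limConn (j + 1) (half (p + digit j)) (tab (base j p) d)) := by
  obtain ⟨s, h1, h2⟩ := ((Filter.tendsto_add_atTop_nat 1).eventually (limConn_spec j p d)).and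
    (limConn_spec (j + 1) (half (p + digit j)) (tab (base j p) d)) |>.exists
  rw [← h1, ← h2]
  have e : p + offset j (s + 1 + 1)
      = (2 : ℤ) • (half (p + digit j) + offset (j + 1) (s + 1)) := by
    rw [smul_add, ← ((isEven_base_iff j p).1 hp).eq_two_smul, offset]
    abel
  have hred := red_add_offset j s p
  rw [e] at hred ⊢
  rw [connPow_two_smul, tab_congr hred]

/-! ### The walk along the curves of the limit -/

/-- The oriented segment obtained by reversing the orientation. -/
def rev (x : Z3 × Fin 6) : Z3 × Fin 6 := (x.1 + dir x.2, opp x.2)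

lemma rev_ne (x : Z3 × Fin 6) : rev x ≠ x := by
  intro h
  exact absurd (congrArg Prod.snd h) ((by decide : ∀ d, opp d ≠ d) x.2)

/-- The map which sends each oriented segment to the following one. -/
def walk (j : ℕ) : Equiv.Perm (Z3 × Fin 6) where
  toFun x := (x.1 + dir x.2, limConn j (x.1 + dir x.2) (opp x.2))
  invFun x := (x.1 + dir (limConn j x.1 x.2), opp (limConn j x.1 x.2))
  left_inv x := by simp [limConn_limConn, add_dir_opp]
  right_inv x := by simp [limConn_limConn, add_dir_opp]

lemma walk_apply (j : ℕ) (x : Z3 × Fin 6) :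
    walk j x = (x.1 + dir x.2, limConn j (x.1 + dir x.2) (opp x.2)) := rfl

lemma walk_rev_walk (j : ℕ) (x : Z3 × Fin 6) : walk j (rev (walk j x)) = rev x := by
  simp [walk_apply, rev, add_dir_opp, limConn_limConn]

lemma rev_walk (j : ℕ) (x : Z3 × Fin 6) : rev (walk j x) = (walk j)⁻¹ (rev x) := by
  rw [Equiv.Perm.eq_inv_iff_eq, walk_rev_walk]

lemma rev_walk_zpow (j : ℕ) (i : ℤ) (x : Z3 × Fin 6) :
    rev ((walk j ^ i) x) = (walk j ^ (-i)) (rev x) := by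
  induction i generalizing x with
  | zero => rfl
  | succ i ih =>
    rw [zpow_add_one, Equiv.Perm.mul_apply, ih, rev_walk, neg_add, zpow_add, zpow_neg_one,
      Equiv.Perm.mul_apply]
  | pred i ih =>
    rw [zpow_sub_one, Equiv.Perm.mul_apply, ih, neg_sub, sub_neg_eq_add, add_comm, neg_neg,
      zpow_add_one, Equiv.Perm.mul_apply]
    congr 1
    rw [← Equiv.Perm.inv_eq_iff_eq, ← rev_walk]; simp

/-- The oriented segment of the next limit whose associated curve contains a given one. -/
def parent (j : ℕ) (x : Z3 × Fin 6) : Z3 × Fin 6 :=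
  (half (x.1 + digit j + (posn 8 (base j x.1) x.2).1), (posn 8 (base j x.1) x.2).2.1)

/-- The index of an oriented segment in the curve associated with its parent. -/
def index (j : ℕ) (x : Z3 × Fin 6) : ℕ := (posn 8 (base j x.1) x.2).2.2

lemma two_smul_parent (j : ℕ) (x : Z3 × Fin 6) :
    (2 : ℤ) • (parent j x).1 = x.1 + digit j + (posn 8 (base j x.1) x.2).1 := by
  refine (IsEven.eq_two_smul ?_).symm
  convert (posn_bounds (base j x.1) x.2).1.sub (isEven_two_smul (digit (j + 1))) using 1
  simp only [base]; abel

lemma index_lt (j : ℕ) (x : Z3 × Fin 6) : index j x < 8 := (posn_bounds _ _).2.1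

lemma parent_of_isEven {j : ℕ} {x : Z3 × Fin 6} (h : IsEven (base j x.1)) :
    parent j x = (half (x.1 + digit j), tab (base j x.1) x.2) := by
  simp [parent, posn_of_isEven h]

lemma index_eq_zero_iff {j : ℕ} {x : Z3 × Fin 6} : index j x = 0 ↔ IsEven (base j x.1) := by
  refine ⟨fun h => ?_, fun h => by simp [index, posn_of_isEven h]⟩
  by_contra hx
  have := (posn_of_not_isEven hx x.2).2.2
  simp only [index] at h
  omega

lemma parent_rev (j : ℕ) (x : Z3 × Fin 6) : parent j (rev x) = rev (parent j x) := by
  obtain ⟨h1, h2⟩ := posn_reverse (base j x.1) x.2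
  refine Prod.ext (two_smul_injective ?_) ?_
  · simp only [two_smul_parent]
    simp only [rev, smul_add, two_smul_parent, base_add]
    calc
      _ = x.1 + digit j + (dir x.2 + (posn 8 (base j x.1 + dir x.2) (opp x.2)).1) := by abel
      _ = _ := by rw [h1]; simp only [parent]; abel
  · simpa only [parent, rev, base_add] using h2

lemma parent_walk_of_not_isEven {j : ℕ} {x : Z3 × Fin 6}
    (h : ¬ IsEven (base j (x.1 + dir x.2))) :
    parent j (walk j x) = parent j x ∧ index j (walk j x) = index j x + 1 := by
  obtain ⟨h1, h2, h3⟩ := posn_of_not_isEven h (walk j x).2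
  have e : tab (base j (x.1 + dir x.2)) (walk j x).2 = opp x.2 := by
    rw [walk_apply, limConn_of_not_isEven h, tab_tab]
  rw [e, opp_opp, ← base_add, add_dir_opp] at h1 h2 h3
  refine ⟨Prod.ext (two_smul_injective ?_) h2, h3⟩
  simp only [two_smul_parent]
  rw [show (walk j x).1 = x.1 + dir x.2 from rfl, h1, dir_opp]
  abel

lemma parent_walk_of_isEven {j : ℕ} {x : Z3 × Fin 6} (h : IsEven (base j (x.1 + dir x.2))) :
    parent j (walk j x) = walk (j + 1) (parent j x) ∧ index j x = 7 ∧
      index j (walk j x) = 0 := by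
  have h' := h
  rw [base_add] at h'
  obtain ⟨h1, h2, h3⟩ := posn_last h'
  have hpt : half (x.1 + dir x.2 + digit j) = (parent j x).1 + dir (parent j x).2 := by
    apply two_smul_injective
    simp only [smul_add, two_smul_parent]
    rw [← ((isEven_base_iff _ _).1 h).eq_two_smul]
    simp only [parent]
    nth_rewrite 1 [h2]
    abel
  refine ⟨?_, h1, index_eq_zero_iff.2 h⟩
  rw [parent_of_isEven (x := walk j x) h, walk_apply, walk_apply, ← hpt]
  refine Prod.ext rfl ?_
  simp only
  rw [limConn_of_isEven h, tab_tab, base_add, h3]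
  rfl

lemma index_walk_pow (j m : ℕ) (x : Z3 × Fin 6) :
    index j ((walk j ^ m) x) = (index j x + m) % 8 ∧
    parent j ((walk j ^ m) x) = (walk (j + 1) ^ ((index j x + m) / 8)) (parent j x) := by
  induction m with
  | zero =>
    have := index_lt j x
    simp [Nat.mod_eq_of_lt this, Nat.div_eq_of_lt this]
  | succ m ih =>
    obtain ⟨h1, h2⟩ := ih
    rw [pow_succ', Equiv.Perm.mul_apply]
    set y := (walk j ^ m) x
    by_cases h : IsEven (base j (y.1 + dir y.2))
    · obtain ⟨h3, h4, h5⟩ := parent_walk_of_isEven h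
      refine ⟨by omega, ?_⟩
      rw [h3, h2, ← Equiv.Perm.mul_apply, ← pow_succ']
      congr 2
      omega
    · obtain ⟨h3, h4⟩ := parent_walk_of_not_isEven h
      have := index_lt j (walk j y)
      refine ⟨by omega, ?_⟩
      rw [h3, h2]
      congr 2
      omega

lemma walk_pow_ne {n : ℕ} (hn : n ≠ 0) (j : ℕ) (x : Z3 × Fin 6) : (walk j ^ n) x ≠ x := by
  induction n using Nat.strong_induction_on generalizing j x with
  | _ n ih =>
    intro h
    obtain ⟨h1, h2⟩ := index_walk_pow j n x
    rw [h] at h1 h2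
    have := index_lt j x
    exact ih ((index j x + n) / 8) (by omega) (by omega) (j + 1) _ h2.symm

lemma walk_zpow_injective (j : ℕ) (x : Z3 × Fin 6) :
    Function.Injective fun i : ℤ => (walk j ^ i) x := by
  have key : ∀ i k : ℤ, i < k → (walk j ^ i) x ≠ (walk j ^ k) x := fun i k hik h => by
    refine walk_pow_ne (n := (k - i).toNat) (by omega) j ((walk j ^ i) x) ?_
    rw [← zpow_natCast, ← Equiv.Perm.mul_apply, ← zpow_add, h]
    congr 2
    omega
  intro i k h
  rcases lt_trichotomy i k with hik | hik | hik
  · exact absurd h (key i k hik)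
  · exact hik
  · exact absurd h.symm (key k i hik)

open Equiv.Perm in
lemma sameCycle_of_parent_eq {j : ℕ} {x y : Z3 × Fin 6} (h : parent j x = parent j y) :
    SameCycle (walk j) x y := by
  have first (k : ℕ) : ∀ x, index j x = k →
      ∃ x', index j x' = 0 ∧ parent j x' = parent j x ∧ SameCycle (walk j) x x' := by
    induction k with
    | zero => exact fun x hx => ⟨x, hx, rfl, SameCycle.refl _ _⟩
    | succ k ih =>
      intro x hx
      obtain ⟨w, rfl⟩ := (walk j).surjective x
      have hw : ¬ IsEven (base j (w.1 + dir w.2)) := fun h => by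
        have := (parent_walk_of_isEven h).2.2
        omega
      obtain ⟨h1, h2⟩ := parent_walk_of_not_isEven hw
      obtain ⟨x', h3, h4, h5⟩ := ih w (by omega)
      exact ⟨x', h3, h4.trans h1.symm, (sameCycle_apply_left.2 h5)⟩
  obtain ⟨x', hx, hx', hxx⟩ := first _ x rfl
  obtain ⟨y', hy, hy', hyy⟩ := first _ y rfl
  have e : x' = y' := by
    rw [index_eq_zero_iff] at hx hy
    have hp : parent j x' = parent j y' := by rw [hx', hy', h]
    have h1 := two_smul_parent j x'
    rw [hp, two_smul_parent, posn_of_isEven hx, posn_of_isEven hy] at h1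
    have h1' : y'.1 = x'.1 := by simpa using h1
    rw [parent_of_isEven hx, parent_of_isEven hy, h1'] at hp
    have h2 := congrArg (tab (base j x'.1)) (congrArg Prod.snd hp)
    simp only [tab_tab] at h2
    exact Prod.ext h1'.symm h2
  exact hxx.trans (e ▸ hyy.symm)

open Equiv.Perm in
lemma sameCycle_of_sameCycle_parent {j : ℕ} {x y : Z3 × Fin 6}
    (h : SameCycle (walk (j + 1)) (parent j x) (parent j y)) : SameCycle (walk j) x y := by
  have key (n : ℕ) : ∀ x y, (walk (j + 1) ^ n) (parent j x) = parent j y →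
      SameCycle (walk j) x y := by
    intro x y hxy
    have hle := index_lt j x
    have h1 := (index_walk_pow j (8 * n) x).2
    rw [show (index j x + 8 * n) / 8 = n by omega, hxy] at h1
    exact sameCycle_pow_left.1 (sameCycle_of_parent_eq h1)
  obtain ⟨i, hi⟩ := h
  rcases Int.eq_nat_or_neg i with ⟨n, rfl | rfl⟩
  · exact key n x y (by simpa using hi)
  · refine (key n y x ?_).symm
    rw [← hi, zpow_neg, zpow_natCast]; simp

/-! ### All the segments of the limit belong to the same curve -/

/-- The ancestor, `n` generations above, of an oriented segment of the `j`-th limit. -/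
def ancestor (j : ℕ) : ℕ → Z3 × Fin 6 → Z3 × Fin 6
  | 0, x => x
  | n + 1, x => parent (j + n) (ancestor j n x)

lemma ancestor_rev (j n : ℕ) (x : Z3 × Fin 6) : ancestor j n (rev x) = rev (ancestor j n x) := by
  induction n with
  | zero => rfl
  | succ n ih => rw [ancestor, ih, parent_rev, ancestor]

lemma ancestor_add (n k : ℕ) (x : Z3 × Fin 6) :
    ancestor 0 (n + k) x = ancestor n k (ancestor 0 n x) := by
  induction k with
  | zero => rfl
  | succ k ih => rw [← add_assoc, ancestor, ancestor, ih, zero_add]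

lemma ancestor_three_mul (m k : ℕ) (x : Z3 × Fin 6) : ancestor (3 * m) k x = ancestor 0 k x := by
  have hd (i : ℕ) : digit (3 * m + i) = digit i := by simp [digit]
  induction k with
  | zero => rfl
  | succ k ih =>
    rw [ancestor, ancestor, ih]
    simp only [parent, base, add_assoc, hd, zero_add]

lemma sameCycle_of_ancestor {n : ℕ} {x y : Z3 × Fin 6}
    (h : Equiv.Perm.SameCycle (walk n) (ancestor 0 n x) (ancestor 0 n y)) :
    Equiv.Perm.SameCycle (walk 0) x y := by
  induction n with
  | zero => exact h
  | succ n ih =>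
    simp only [ancestor, zero_add] at h
    exact ih (sameCycle_of_sameCycle_parent h)

lemma digit_bounds (j : ℕ) : (0 ≤ (digit j).1 ∧ (digit j).1 ≤ 1) ∧
    (0 ≤ (digit j).2.1 ∧ (digit j).2.1 ≤ 1) ∧ 0 ≤ (digit j).2.2 ∧ (digit j).2.2 ≤ 1 := by
  unfold digit
  split <;> simp

/-- The points with coordinates in `[-2 - M, 3 + M]`. -/
def InBox (M : ℕ) (p : Z3) : Prop :=
  (-2 - (M : ℤ) ≤ p.1 ∧ p.1 ≤ 3 + M) ∧ (-2 - (M : ℤ) ≤ p.2.1 ∧ p.2.1 ≤ 3 + M) ∧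
    -2 - (M : ℤ) ≤ p.2.2 ∧ p.2.2 ≤ 3 + M

lemma inBox_parent {M : ℕ} {x : Z3 × Fin 6} (h : InBox M x.1) (j : ℕ) :
    InBox (M / 2) (parent j x).1 := by
  have h1 := two_smul_parent j x
  have h2 := (posn_bounds (base j x.1) x.2).2.2
  have h3 := digit_bounds j
  simp only [Prod.ext_iff, Prod.smul_fst, Prod.smul_snd, Prod.fst_add, Prod.snd_add,
    smul_eq_mul] at h1
  simp only [InBox] at h ⊢
  omega

lemma eventually_inBox_ancestor (x : Z3 × Fin 6) :
    ∀ᶠ n in Filter.atTop, InBox 0 (ancestor 0 n x).1 := by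
  have hx : InBox (x.1.1.natAbs + x.1.2.1.natAbs + x.1.2.2.natAbs) x.1 := by
    simp only [InBox]; omega
  generalize x.1.1.natAbs + x.1.2.1.natAbs + x.1.2.2.natAbs = M at hx
  have key (n : ℕ) : InBox (M / 2 ^ n) (ancestor 0 n x).1 := by
    induction n with
    | zero => simpa [ancestor] using hx
    | succ n ih =>
      rw [pow_succ, ← Nat.div_div_eq_div_mul]
      exact inBox_parent ih _
  refine Filter.eventually_atTop.2 ⟨M, fun n hn => ?_⟩
  have := key n
  rwa [Nat.div_eq_of_lt (hn.trans_lt Nat.lt_two_pow_self)] at this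

/-- A box which contains the ancestors, three generations above, of the points of `InBox 0`. -/
def InSmallBox (p : Z3) : Prop :=
  (-1 ≤ p.1 ∧ p.1 ≤ 1) ∧ (-1 ≤ p.2.1 ∧ p.2.1 ≤ 2) ∧ 0 ≤ p.2.2 ∧ p.2.2 ≤ 2

instance (p : Z3) : Decidable (InSmallBox p) := inferInstanceAs (Decidable (_ ∧ _))

lemma inSmallBox_ancestor_three {x : Z3 × Fin 6} (h : InBox 0 x.1) :
    InSmallBox (ancestor 0 3 x).1 := by
  have key : ∀ a b c d : Fin 6, InSmallBox
      (ancestor 0 3 (((a.val : ℤ) - 2, (b.val : ℤ) - 2, (c.val : ℤ) - 2), d)).1 := by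
    decide +kernel
  obtain ⟨⟨a, b, c⟩, d⟩ := x
  simp only [InBox] at h
  have := key ⟨(a + 2).toNat, by omega⟩ ⟨(b + 2).toNat, by omega⟩ ⟨(c + 2).toNat, by omega⟩ d
  have h1 : ((a + 2).toNat : ℤ) - 2 = a := by omega
  have h2 : ((b + 2).toNat : ℤ) - 2 = b := by omega
  have h3 : ((c + 2).toNat : ℤ) - 2 = c := by omega
  simpa only [h1, h2, h3] using this

lemma ancestor_six {x : Z3 × Fin 6} (h : InSmallBox x.1) :
    ancestor 0 6 x = ((0, 0, 1), 2) ∨ ancestor 0 6 x = ((0, 1, 1), 3) := by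
  have key : ∀ (a : Fin 3) (b : Fin 4) (c : Fin 3) (d : Fin 6),
      ancestor 0 6 (((a.val : ℤ) - 1, (b.val : ℤ) - 1, (c.val : ℤ)), d) = ((0, 0, 1), 2) ∨
      ancestor 0 6 (((a.val : ℤ) - 1, (b.val : ℤ) - 1, (c.val : ℤ)), d) = ((0, 1, 1), 3) := by
    decide +kernel
  obtain ⟨⟨a, b, c⟩, d⟩ := x
  simp only [InSmallBox] at h
  have := key ⟨(a + 1).toNat, by omega⟩ ⟨(b + 1).toNat, by omega⟩ ⟨c.toNat, by omega⟩ d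
  have h1 : ((a + 1).toNat : ℤ) - 1 = a := by omega
  have h2 : ((b + 1).toNat : ℤ) - 1 = b := by omega
  have h3 : (c.toNat : ℤ) = c := by omega
  simpa only [h1, h2, h3] using this

lemma ancestor_nine {x : Z3 × Fin 6} (h : InBox 0 x.1) :
    ancestor 0 9 x = ((0, 0, 1), 2) ∨ ancestor 0 9 x = ((0, 1, 1), 3) := by
  rw [ancestor_add 3 6, ← mul_one 3, ancestor_three_mul 1]
  exact ancestor_six (inSmallBox_ancestor_three h)

lemma exists_ancestor_eq (x y : Z3 × Fin 6) :
    ∃ n, ancestor 0 n x = ancestor 0 n y ∨ ancestor 0 n x = rev (ancestor 0 n y) := by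
  have ht : Filter.Tendsto (fun m : ℕ => 3 * m) Filter.atTop Filter.atTop :=
    Filter.tendsto_id.const_mul_atTop' (by norm_num)
  obtain ⟨m, hx, hy⟩ := (ht.eventually
    ((eventually_inBox_ancestor x).and (eventually_inBox_ancestor y))).exists
  refine ⟨3 * m + 9, ?_⟩
  simp only [ancestor_add, ancestor_three_mul]
  rcases ancestor_nine hx with h | h <;> rcases ancestor_nine hy with h' | h' <;>
    simp [h, h', rev, dir, opp]

lemma sameCycle_or_sameCycle_rev (x y : Z3 × Fin 6) :
    Equiv.Perm.SameCycle (walk 0) x y ∨ Equiv.Perm.SameCycle (walk 0) x (rev y) := by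
  obtain ⟨n, h | h⟩ := exists_ancestor_eq x y
  · exact Or.inl (sameCycle_of_ancestor (n := n) (h ▸ Equiv.Perm.SameCycle.refl _ _))
  · rw [← ancestor_rev] at h
    exact Or.inr (sameCycle_of_ancestor (n := n) (h ▸ Equiv.Perm.SameCycle.refl _ _))

lemma limConn_ne (p : Z3) (d : Fin 6) : limConn 0 p d ≠ d := by
  intro hd
  have key (n : ℕ) : ∃ q, ∃ g : Fin 6 → Fin 6, Function.Injective g ∧
      (∀ e, ancestor 0 n (p, e) = (q, g e)) ∧ ∃ e, limConn n q e = e := by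
    induction n with
    | zero => exact ⟨p, id, Function.injective_id, fun _ => rfl, d, hd⟩
    | succ n ih =>
      obtain ⟨q, g, hg, h, e, he⟩ := ih
      have hq : IsEven (base n q) := by
        by_contra hq
        rw [limConn_of_not_isEven hq] at he
        exact tab_ne hq e he
      refine ⟨half (q + digit n), fun e => tab (base n q) (g e), fun a b hab => hg ?_,
        fun e => ?_, tab (base n q) e, ?_⟩
      · have := congrArg (tab (base n q)) hab
        simpa only [tab_tab] using this
      · rw [ancestor, h, zero_add, parent_of_isEven hq]
      · rw [limConn_of_isEven hq] at he
        conv_rhs => rw [← he, tab_tab]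
  obtain ⟨n, hn⟩ := exists_ancestor_eq (p, 0) (p, 1)
  obtain ⟨q, g, hg, h, -⟩ := key n
  rw [h, h] at hn
  rcases hn with hn | hn
  · exact absurd (hg (congrArg Prod.snd hn)) (by decide)
  · have := congrArg Prod.fst hn
    simp only [rev, left_eq_add] at this
    revert this
    generalize g 1 = e
    revert e
    decide

lemma walk_zpow_ne_rev (i : ℤ) (x : Z3 × Fin 6) : (walk 0 ^ i) x ≠ rev x := by
  intro h
  obtain ⟨m, rfl | rfl⟩ := Int.even_or_odd' i
  · refine rev_ne ((walk 0 ^ m) x) ?_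
    rw [rev_walk_zpow, ← h, ← Equiv.Perm.mul_apply, ← zpow_add]
    congr 2
    ring
  · have h1 : rev ((walk 0 ^ m) x) = walk 0 ((walk 0 ^ m) x) := by
      rw [rev_walk_zpow, ← h, ← Equiv.Perm.mul_apply, ← zpow_add, ← Equiv.Perm.mul_apply,
        ← zpow_one_add]
      congr 2
      ring
    have h2 := congrArg Prod.snd h1
    exact limConn_ne _ _ h2.symm

/-! ### Integer points and lattice segments -/

/-- The canonical embedding of `ℤ³` into `ℝ³`. -/
def emb (p : Z3) : Pt 3 := p3 p.1 p.2.1 p.2.2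

lemma emb_apply_zero (p : Z3) : emb p 0 = p.1 := rfl

lemma emb_apply_one (p : Z3) : emb p 1 = p.2.1 := rfl

lemma emb_apply_two (p : Z3) : emb p 2 = p.2.2 := rfl

lemma pt3_ext {x y : Pt 3} (h0 : x 0 = y 0) (h1 : x 1 = y 1) (h2 : x 2 = y 2) : x = y := by
  ext i
  fin_cases i
  exacts [h0, h1, h2]

lemma emb_injective : Function.Injective emb := fun p q h => by
  have h0 := congrArg (fun x : Pt 3 => x 0) h
  have h1 := congrArg (fun x : Pt 3 => x 1) h
  have h2 := congrArg (fun x : Pt 3 => x 2) h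
  simp only [emb_apply_zero, emb_apply_one, emb_apply_two, Int.cast_inj] at h0 h1 h2
  exact Prod.ext h0 (Prod.ext h1 h2)

@[simp] lemma emb_inj {p q : Z3} : emb p = emb q ↔ p = q := emb_injective.eq_iff

lemma emb_add (p q : Z3) : emb (p + q) = emb p + emb q := by
  apply pt3_ext <;> simp [emb_apply_zero, emb_apply_one, emb_apply_two]

lemma emb_neg (p : Z3) : emb (-p) = -emb p := by
  apply pt3_ext <;> simp [emb_apply_zero, emb_apply_one, emb_apply_two]

lemma emb_zero : emb 0 = 0 := by
  apply pt3_ext <;> simp [emb_apply_zero, emb_apply_one, emb_apply_two]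

lemma emb_smul (m : ℤ) (p : Z3) : emb (m • p) = (m : ℝ) • emb p := by
  apply pt3_ext <;> simp [emb_apply_zero, emb_apply_one, emb_apply_two]

lemma emb_two_smul (p : Z3) : emb ((2 : ℤ) • p) = ((2 : ℕ) : ℝ) • emb p := by
  rw [emb_smul]; norm_num

lemma latt_emb (p : Z3) : latt (emb p) := by
  intro i
  fin_cases i
  exacts [⟨_, emb_apply_zero p⟩, ⟨_, emb_apply_one p⟩, ⟨_, emb_apply_two p⟩]

lemma latt_iff {x : Pt 3} : latt x ↔ ∃ p, x = emb p := by
  refine ⟨fun h => ?_, fun ⟨p, hp⟩ => hp ▸ latt_emb p⟩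
  obtain ⟨a, ha⟩ := h 0
  obtain ⟨b, hb⟩ := h 1
  obtain ⟨c, hc⟩ := h 2
  exact ⟨(a, b, c), pt3_ext ha hb hc⟩

lemma inLat_two_iff {p : Z3} : inLat 2 (emb p) ↔ IsEven p := by
  have key (a : ℤ) : (∃ c : ℤ, (a : ℝ) = ((2 : ℕ) : ℝ) * c) ↔ a % 2 = 0 := by
    refine ⟨fun ⟨c, hc⟩ => ?_, fun h => ⟨a / 2, ?_⟩⟩
    · have : a = 2 * c := by exact_mod_cast hc
      omega
    · have : a = 2 * (a / 2) := by omega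
      exact_mod_cast this
  rw [inLat, Fin.forall_fin_succ, Fin.forall_fin_two, IsEven]
  exact and_congr (key p.1) (and_congr (key p.2.1) (key p.2.2))

/-- The direction `e_i`. -/
def posDir (i : Fin 3) : Fin 6 := ![0, 2, 4] i

lemma uvec_eq (i : Fin 3) : uvec 3 i = emb (dir (posDir i)) := by
  fin_cases i <;> apply pt3_ext <;>
    simp [uvec, emb_apply_zero, emb_apply_one, emb_apply_two, dir, posDir]

lemma eq_posDir (d : Fin 6) : ∃ i, d = posDir i ∨ d = opp (posDir i) := by
  revert d; decide

lemma emb_dir (d : Fin 6) : ∃ i, emb (dir d) = uvec 3 i ∨ emb (dir d) = -uvec 3 i := by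
  obtain ⟨i, rfl | rfl⟩ := eq_posDir d
  · exact ⟨i, Or.inl (uvec_eq i).symm⟩
  · exact ⟨i, Or.inr (by rw [dir_opp, emb_neg, uvec_eq])⟩

lemma isDir_iff {u : Pt 3} : IsDir u ↔ ∃ d, u = emb (dir d) := by
  refine ⟨?_, fun ⟨d, hd⟩ => hd ▸ emb_dir d⟩
  rintro ⟨i, rfl | rfl⟩
  · exact ⟨_, uvec_eq i⟩
  · exact ⟨opp (posDir i), by rw [dir_opp, emb_neg, uvec_eq]⟩

/-- The segment `[p, p + dir d]`. -/
def seg (p : Z3) (d : Fin 6) : Sym2 (Pt 3) := s(emb p, emb (p + dir d))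

lemma seg_opp (p : Z3) (d : Fin 6) : seg (p + dir d) (opp d) = seg p d := by
  rw [seg, add_dir_opp, Sym2.eq_swap, seg]

lemma seg_eq_seg {p q : Z3} {d e : Fin 6} :
    seg p d = seg q e ↔ (p, d) = (q, e) ∨ (p, d) = rev (q, e) := by
  simp only [seg, Sym2.eq_iff, emb_inj, Prod.mk.injEq, rev]
  refine or_congr (and_congr_right ?_) (and_congr_right ?_)
  · rintro rfl
    rw [add_right_inj, dir_injective.eq_iff]
  · rintro rfl
    constructor
    · intro h
      apply dir_injective
      rw [dir_opp, ← add_right_inj (q + dir e), h]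
      abel
    · rintro rfl
      exact add_dir_opp q e

lemma dir_ne_zero (d : Fin 6) : dir d ≠ 0 := by revert d; decide

lemma seg_left_inj {p : Z3} {d e : Fin 6} : seg p d = seg p e ↔ d = e := by
  refine ⟨fun h => ?_, fun h => h ▸ rfl⟩
  rcases seg_eq_seg.1 h with h | h
  · exact congrArg Prod.snd h
  · have := congrArg Prod.fst h
    simp only [rev, left_eq_add] at this
    exact absurd this (dir_ne_zero e)

lemma isSeg_iff {S : Sym2 (Pt 3)} : IsSeg S ↔ ∃ p d, S = seg p d := by
  constructor
  · rintro ⟨x, i, hx, rfl⟩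
    obtain ⟨p, rfl⟩ := latt_iff.1 hx
    exact ⟨p, posDir i, by rw [seg, emb_add, uvec_eq]⟩
  · have key (p i) : IsSeg (seg p (posDir i)) :=
      ⟨emb p, i, latt_emb p, by rw [seg, emb_add, uvec_eq]⟩
    rintro ⟨p, d, rfl⟩
    obtain ⟨i, rfl | rfl⟩ := eq_posDir d
    · exact key p i
    · rw [← seg_opp, opp_opp]
      exact key _ i

lemma isSeg_seg (p : Z3) (d : Fin 6) : IsSeg (seg p d) := isSeg_iff.2 ⟨p, d, rfl⟩

lemma exists_dir_of_isSeg {a b : Pt 3} (h : IsSeg s(a, b)) :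
    ∃ p d, a = emb p ∧ b = emb (p + dir d) := by
  obtain ⟨p, d, hpd⟩ := isSeg_iff.1 h
  rcases Sym2.eq_iff.1 hpd with ⟨rfl, rfl⟩ | ⟨rfl, rfl⟩
  · exact ⟨p, d, rfl, rfl⟩
  · exact ⟨p + dir d, opp d, rfl, by rw [add_dir_opp]⟩

lemma map_add_seg (p z : Z3) (d : Fin 6) :
    Sym2.map (fun x => x + emb z) (seg p d) = seg (p + z) d := by
  rw [seg, Sym2.map_mk, seg, ← emb_add, ← emb_add, add_right_comm]

/-- The trace with all the lattice segments and with the connexions between `[p, p + dir d]` and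
`[p, p + dir e]` for `f p d e`. -/
def mkTrace (f : Z3 → Fin 6 → Fin 6 → Prop) : Trace 3 :=
  ⟨{S | IsSeg S}, fun S T => ∃ p d e, S = seg p d ∧ T = seg p e ∧ f p d e⟩

lemma trace_ext {T T' : Trace 3} (h : ∀ S, S ∈ T.segs ↔ S ∈ T'.segs)
    (h' : ∀ S S', T.conn S S' ↔ T'.conn S S') : T = T' := by
  cases T; cases T'
  obtain rfl := Set.ext h
  obtain rfl : _ = _ := funext fun S => funext fun S' => propext (h' S S')
  rfl

/-! ### The connexions of `𝒞` -/

/-- The vertices of the curves of `ℬ₀`. -/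
def blockZero : List (List Z3) :=
  [ [(0, 0, 0), (0, -1, 0), (0, -1, -1), (0, 0, -1), (1, 0, -1),
     (1, -1, -1), (1, -1, 0), (1, 0, 0), (2, 0, 0)],
    [(0, 0, 0), (0, 0, 1), (0, 1, 1), (0, 1, 0), (-1, 1, 0), (-1, 1, 1),
     (-1, 0, 1), (-1, 0, 0), (-2, 0, 0)],
    [(0, 0, 0), (0, 0, -1), (-1, 0, -1), (-1, 0, 0), (-1, 1, 0),
     (-1, 1, -1), (0, 1, -1), (0, 1, 0), (0, 2, 0)],
    [(0, 0, 0), (1, 0, 0), (1, 0, 1), (0, 0, 1), (0, -1, 1), (1, -1, 1),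
     (1, -1, 0), (0, -1, 0), (0, -2, 0)],
    [(0, 0, 0), (-1, 0, 0), (-1, -1, 0), (0, -1, 0), (0, -1, 1),
     (-1, -1, 1), (-1, 0, 1), (0, 0, 1), (0, 0, 2)],
    [(0, 0, 0), (0, 1, 0), (1, 1, 0), (1, 0, 0), (1, 0, -1), (1, 1, -1),
     (0, 1, -1), (0, 0, -1), (0, 0, -2)] ]

/-- The vertices of the curves of `ℬ₀, ℬ₁, ℬ₂, ℬ₃`. -/
def blocks : Fin 4 → List (List Z3) :=
  ![blockZero,
    blockZero.map (List.map fun p => (2 + p.1, 2 - p.2.1, -p.2.2)),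
    blockZero.map (List.map fun p => (2 + p.1, p.2.2, 2 - p.2.1)),
    blockZero.map (List.map fun p => (p.1, 2 - p.2.2, 2 + p.2.1))]

lemma blockLists_eq (i : Fin 4) : blockLists i = (blocks i).map (List.map emb) := by
  have h0 : B0 = blockZero.map (List.map emb) := by
    simp only [B0, CList, blockZero, List.map_cons, List.map_nil, emb]
  have key (f : Pt 3 → Pt 3) (g : Z3 → Z3) (h : ∀ p, f (emb p) = emb (g p)) :
      B0.map (List.map f) = (blockZero.map (List.map g)).map (List.map emb) := by
    rw [h0, List.map_map, List.map_map]
    congr 1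
    funext L
    simp [h]
  fin_cases i
  · exact h0
  all_goals
    refine key _ _ fun p => pt3_ext ?_ ?_ ?_ <;>
      simp [emb, p3, toPt3, sigma3, tau3, ups3, sub_eq_add_neg]

lemma blocks_forward : ∀ i, ∀ L ∈ blocks i, L.length = 9 ∧ ∀ j < 7,
    ¬ IsEven (L.getD (j + 1) 0) ∧ ∃ d, L.getD j 0 = L.getD (j + 1) 0 + dir d ∧
      L.getD (j + 2) 0 = L.getD (j + 1) 0 + dir (tab (L.getD (j + 1) 0) d) := by
  decide +kernel

lemma blocks_backward {y : Z3} (hy : ¬ IsEven y) (d : Fin 6) :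
    ∃ i, ∃ L ∈ blocks i, ∃ j < 7, red (L.getD (j + 1) 0) = red y ∧
      ((L.getD j 0 = L.getD (j + 1) 0 + dir d ∧
        L.getD (j + 2) 0 = L.getD (j + 1) 0 + dir (tab y d)) ∨
       (L.getD j 0 = L.getD (j + 1) 0 + dir (tab y d) ∧
        L.getD (j + 2) 0 = L.getD (j + 1) 0 + dir d)) := by
  rw [← red_red, ← tab_red]
  rw [← isEven_red] at hy
  revert hy d
  exact forall_red (Q := fun y => ¬ IsEven y → ∀ d,
    ∃ i, ∃ L ∈ blocks i, ∃ j < 7, red (L.getD (j + 1) 0) = red y ∧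
      ((L.getD j 0 = L.getD (j + 1) 0 + dir d ∧
        L.getD (j + 2) 0 = L.getD (j + 1) 0 + dir (tab y d)) ∨
       (L.getD j 0 = L.getD (j + 1) 0 + dir (tab y d) ∧
        L.getD (j + 2) 0 = L.getD (j + 1) 0 + dir d))) (by decide +kernel) y

lemma exists_eq_add_of_red_eq {p q : Z3} (h : red p = red q) : ∃ t : Z3, q = p + (4 : ℤ) • t := by
  obtain ⟨t, ht⟩ := exists_eq_red_add p
  obtain ⟨t', ht'⟩ := exists_eq_red_add q
  refine ⟨t' - t, ?_⟩
  nth_rewrite 1 [ht', ← h, ht]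
  rw [show red (red p + (4 : ℤ) • t) = red p by rw [← ht]]
  nth_rewrite 2 [ht]
  module

lemma seg_of_eq {p q : Z3} {d : Fin 6} (h : q = p + dir d) : s(emb p, emb q) = seg p d := by
  rw [h, seg]

lemma seg_of_eq_swap {p q : Z3} {d : Fin 6} (h : q = p + dir d) : s(emb q, emb p) = seg p d := by
  rw [h, seg, Sym2.eq_swap]

lemma cTrace_conn_iff {S T : Sym2 (Pt 3)} :
    CTrace.conn S T ↔ ∃ y d, ¬ IsEven y ∧ S = seg y d ∧ T = seg y (tab y d) := by
  have tr (t : Z3) : (4 : ℝ) • emb t = emb ((4 : ℤ) • t) := by rw [emb_smul]; norm_num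
  have tabt (y t : Z3) : tab (y + (4 : ℤ) • t) = tab y := tab_congr (red_add_four _ _)
  constructor
  · rintro ⟨u, hu, i, M, hM, A, B, ⟨j, hj, hAB⟩, rfl, rfl⟩
    obtain ⟨t, rfl⟩ := latt_iff.1 hu
    rw [blockLists_eq, List.mem_map] at hM
    obtain ⟨L, hL, rfl⟩ := hM
    obtain ⟨h9, h⟩ := blocks_forward i L hL
    rw [List.length_map, h9] at hj
    obtain ⟨h1, d, h2, h3⟩ := h j (by omega)
    simp only [← emb_zero, List.getD_map] at hAB
    rw [seg_of_eq h3, seg_of_eq_swap h2] at hAB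
    have h1' : ¬ IsEven (L.getD (j + 1) 0 + (4 : ℤ) • t) := by
      rwa [isEven_congr (red_add_four _ _)]
    rw [tr]
    rcases hAB with ⟨rfl, rfl⟩ | ⟨rfl, rfl⟩
    · exact ⟨_, d, h1', map_add_seg _ _ _, by rw [map_add_seg, tabt]⟩
    · exact ⟨_, tab (L.getD (j + 1) 0) d, h1', map_add_seg _ _ _,
        by rw [map_add_seg, tabt, tab_tab]⟩
  · rintro ⟨y, d, hy, rfl, rfl⟩
    obtain ⟨i, L, hL, j, hj, hred, h⟩ := blocks_backward hy d
    obtain ⟨t, ht⟩ := exists_eq_add_of_red_eq hred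
    refine ⟨emb t, latt_emb t, i, L.map emb, ?_, seg (L.getD (j + 1) 0) d,
      seg (L.getD (j + 1) 0) (tab y d), ⟨j, ?_, ?_⟩, ?_, ?_⟩
    · rw [blockLists_eq]
      exact List.mem_map_of_mem hL
    · rw [List.length_map, (blocks_forward i L hL).1]
      omega
    · simp only [← emb_zero, List.getD_map]
      rcases h with ⟨h1, h2⟩ | ⟨h1, h2⟩
      · exact Or.inl ⟨(seg_of_eq_swap h1).symm, (seg_of_eq h2).symm⟩
      · exact Or.inr ⟨(seg_of_eq_swap h1).symm, (seg_of_eq h2).symm⟩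
    · rw [tr, map_add_seg, ← ht]
    · rw [tr, map_add_seg, ← ht]

/-! ### The curves of `𝒞` -/

namespace Curve

lemma isSeg_of_mem_segs {c : Curve 3} {S : Sym2 (Pt 3)} (h : S ∈ c.segs) : IsSeg S := by
  obtain ⟨i, hi, hi', rfl⟩ := h
  obtain ⟨p, hp⟩ := latt_iff.1 (c.lattice i hi)
  obtain ⟨j, hj⟩ := c.step i hi hi'
  obtain ⟨d, hd⟩ : ∃ d, c.v (i + 1) = emb p + emb (dir d) := by
    rcases hj with hj | hj
    · exact ⟨posDir j, by rw [hj, hp, uvec_eq]⟩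
    · exact ⟨opp (posDir j), by rw [hj, hp, uvec_eq, dir_opp, emb_neg, sub_eq_add_neg]⟩
  exact isSeg_iff.2 ⟨p, d, by rw [hd, hp, seg, emb_add]⟩

lemma left_mem_segs_of_conn {c : Curve 3} {S T : Sym2 (Pt 3)} (h : c.conn S T) : S ∈ c.segs := by
  obtain ⟨i, h1, h2, h⟩ := h
  have hi : i ∈ c.dom := c.ordConn.out h1 h2 ⟨by omega, by omega⟩
  rcases h with ⟨rfl, -⟩ | ⟨-, rfl⟩
  · exact ⟨i - 1, h1, by rwa [sub_add_cancel], by rw [sub_add_cancel]⟩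
  · exact ⟨i, hi, h2, rfl⟩

end Curve

lemma exists_conn_iff {C3 : Set (Curve 3)} (hC3 : traceOf C3 = CTrace)
    {S T : Sym2 (Pt 3)} :
    (∃ c ∈ C3, c.conn S T) ↔ ∃ y d, ¬ IsEven y ∧ S = seg y d ∧ T = seg y (tab y d) := by
  rw [← cTrace_conn_iff, ← hC3]
  rfl

lemma vertex_not_isEven {C3 : Set (Curve 3)} (hC3 : traceOf C3 = CTrace)
    {c : Curve 3} (hc : c ∈ C3) {i : ℤ} (h1 : i - 1 ∈ c.dom)
    (h2 : i + 1 ∈ c.dom) : ∃ y, ¬ IsEven y ∧ c.v i = emb y := by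
  obtain ⟨y, d, hy, hS, hT⟩ :=
    (exists_conn_iff hC3).1 ⟨c, hc, i, h1, h2, Or.inl ⟨rfl, rfl⟩⟩
  refine ⟨y, hy, ?_⟩
  have hne := c.noback i h1 h2
  have hS' : emb y ∈ s(c.v (i - 1), c.v i) := hS ▸ Sym2.mem_mk_left _ _
  have hT' : emb y ∈ s(c.v i, c.v (i + 1)) := hT ▸ Sym2.mem_mk_left _ _
  rw [Sym2.mem_iff] at hS' hT'
  rcases hS' with h | h
  · rcases hT' with h' | h'
    · exact h'.symm
    · exact absurd (h'.symm.trans h) hne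
  · exact h.symm

lemma endSegAt_of_isEven {C3 : Set (Curve 3)} (hC3 : traceOf C3 = CTrace)
    {c : Curve 3} (hc : c ∈ C3) {y : Z3} (hy : IsEven y) {d : Fin 6}
    (h : seg y d ∈ c.segs) : c.endSegAt (emb y) (seg y d) := by
  obtain ⟨i, hi, hi', h⟩ := h
  have key (k : ℤ) (hk : emb y = c.v k) (h1 : k - 1 ∈ c.dom) : k + 1 ∉ c.dom := fun h2 => by
    obtain ⟨z, hz, hz'⟩ := vertex_not_isEven hC3 hc h1 h2
    rw [hz', emb_inj] at hk
    exact hz (hk ▸ hy)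
  rcases Sym2.eq_iff.1 h with ⟨h1, h2⟩ | ⟨h1, h2⟩
  · exact ⟨i, hi, h1, Or.inl ⟨fun h' => key i h1 h' hi', hi', h⟩⟩
  · refine ⟨i + 1, hi', h1, Or.inr ⟨key _ h1 ?_, ?_, ?_⟩⟩ <;> rw [add_sub_cancel_right]
    exacts [hi, hi, h]

lemma isEndpt_of_endSegAt {c : Curve 3} {x : Pt 3} {S : Sym2 (Pt 3)} (h : c.endSegAt x S) :
    c.IsEndpt x := by
  obtain ⟨i, hi, hx, h | h⟩ := h
  · exact ⟨i, hi, hx, Or.inl h.1⟩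
  · exact ⟨i, hi, hx, Or.inr h.1⟩

lemma mem_segs_of_endSegAt {c : Curve 3} {x : Pt 3} {S : Sym2 (Pt 3)} (h : c.endSegAt x S) :
    S ∈ c.segs ∧ x ∈ S := by
  obtain ⟨i, hi, rfl, ⟨-, h1, rfl⟩ | ⟨-, h1, rfl⟩⟩ := h
  · exact ⟨⟨i, hi, h1, rfl⟩, Sym2.mem_mk_left _ _⟩
  · exact ⟨⟨i - 1, h1, by rwa [sub_add_cancel], by rw [sub_add_cancel]⟩, Sym2.mem_mk_right _ _⟩

lemma exists_mem_segs {C3 : Set (Curve 3)} (hH : SatH C3 2 4)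
    {S : Sym2 (Pt 3)} (hS : IsSeg S) : ∃ c ∈ C3, S ∈ c.segs := by
  obtain ⟨-, -, -, ⟨-, hcov⟩, -⟩ := hH
  refine (hcov S hS ?_).1
  obtain ⟨x, i, -, rfl⟩ := hS
  exact ⟨x, ⟨x, _, rfl, 0, le_rfl, zero_le_one, by simp⟩, trivial⟩

lemma seg_tab_mem {C3 : Set (Curve 3)} (hC3 : traceOf C3 = CTrace) (hH : SatH C3 2 4)
    {c : Curve 3} (hc : c ∈ C3) {y : Z3} (hy : ¬ IsEven y) {d : Fin 6}
    (h : seg y d ∈ c.segs) : seg y (tab y d) ∈ c.segs := by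
  obtain ⟨c', hc', hconn⟩ := (exists_conn_iff hC3).2 ⟨y, tab y d, hy, rfl, rfl⟩
  rw [tab_tab] at hconn
  have h1 := Curve.left_mem_segs_of_conn hconn
  obtain ⟨k, hk⟩ := hconn
  have h2 : seg y d ∈ c'.segs :=
    Curve.left_mem_segs_of_conn (T := seg y (tab y d)) ⟨k, hk.1, hk.2.1, hk.2.2.symm⟩
  by_contra hne
  obtain ⟨-, -, -, ⟨⟨-, hdisj⟩, -⟩, -⟩ := hH
  refine hdisj c hc c' hc' (fun hs => hne ?_) _ h h2
  rwa [hs.1]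

lemma seg_posn_mem {C3 : Set (Curve 3)} (hC3 : traceOf C3 = CTrace) (hH : SatH C3 2 4)
    {c : Curve 3} (hc : c ∈ C3) {y : Z3} {d : Fin 6} (h : seg y d ∈ c.segs) :
    seg (y + (posn 8 y d).1) (tab (y + (posn 8 y d).1) (posn 8 y d).2.1) ∈ c.segs := by
  induction hk : (posn 8 y d).2.2 generalizing y d with
  | zero =>
    by_cases hy : IsEven y
    · simpa [posn_of_isEven hy, tab_tab] using h
    · have := (posn_of_not_isEven hy d).2.2
      omega
  | succ k ih =>
    by_cases hy : IsEven y
    · simp [posn_of_isEven hy] at hk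
    · obtain ⟨h1, h2, h3⟩ := posn_of_not_isEven hy d
      have := seg_tab_mem hC3 hH hc hy h
      rw [← seg_opp] at this
      have := ih this (by omega)
      rw [h1, h2]
      convert this using 2 <;> abel_nf

lemma isEndpt_posn {C3 : Set (Curve 3)} (hC3 : traceOf C3 = CTrace) (hH : SatH C3 2 4)
    {c : Curve 3} (hc : c ∈ C3) {y : Z3} {d : Fin 6} (h : seg y d ∈ c.segs) :
    c.IsEndpt (emb (y + (posn 8 y d).1)) ∧
    c.IsEndpt (emb (y + (posn 8 y d).1 + (2 : ℤ) • dir (posn 8 y d).2.1)) := by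
  have key {y d} (h : seg y d ∈ c.segs) : c.IsEndpt (emb (y + (posn 8 y d).1)) :=
    isEndpt_of_endSegAt (endSegAt_of_isEven hC3 hc (posn_bounds y d).1 (seg_posn_mem hC3 hH hc h))
  refine ⟨key h, ?_⟩
  rw [← seg_opp] at h
  have := key h
  rwa [add_assoc, (posn_reverse y d).1, ← add_assoc] at this

lemma isEndpt_of_isEven {C3 : Set (Curve 3)} (hC3 : traceOf C3 = CTrace) (hH : SatH C3 2 4)
    {c : Curve 3} (hc : c ∈ C3) {y : Z3} (hy : IsEven y) {U : Fin 6}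
    (h : seg y (tab y U) ∈ c.segs) :
    c.IsEndpt (emb y) ∧ c.IsEndpt (emb (y + (2 : ℤ) • dir U)) := by
  simpa [posn_of_isEven hy, tab_tab] using isEndpt_posn hC3 hH hc h

lemma eq_or_eq_of_isEndpt {C3 : Set (Curve 3)} (hH : SatH C3 2 4)
    {c : Curve 3} (hc : c ∈ C3) {x y z : Pt 3} (hx : c.IsEndpt x)
    (hy : c.IsEndpt y) (hz : c.IsEndpt z) : x = y ∨ x = z ∨ y = z := by
  obtain ⟨-, -, -, -, h, -⟩ := hH
  obtain ⟨-, a, i, -, -, -, -, h⟩ := h c hc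
  rcases h x hx with h1 | h1 <;> rcases h y hy with h2 | h2 <;> rcases h z hz with h3 | h3 <;>
    simp only [h1, h2, h3, true_or, or_true]

lemma eq_of_seg_mem {C3 : Set (Curve 3)} (hC3 : traceOf C3 = CTrace) (hH : SatH C3 2 4)
    {c : Curve 3} (hc : c ∈ C3) {y : Z3} (hy : IsEven y) {d e : Fin 6}
    (hd : seg y d ∈ c.segs) (he : seg y e ∈ c.segs) : d = e := by
  rw [← tab_tab y d] at hd
  rw [← tab_tab y e] at he
  obtain ⟨h1, h2⟩ := isEndpt_of_isEven hC3 hH hc hy hd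
  obtain ⟨-, h3⟩ := isEndpt_of_isEven hC3 hH hc hy he
  have hz (u : Fin 6) : (2 : ℤ) • dir u ≠ 0 := by revert u; decide
  rcases eq_or_eq_of_isEndpt hH hc h1 h2 h3 with h | h | h
  · rw [emb_inj, left_eq_add] at h
    exact absurd h (hz _)
  · rw [emb_inj, left_eq_add] at h
    exact absurd h (hz _)
  · rw [emb_inj, add_right_inj] at h
    have := dir_injective (two_smul_injective h)
    rw [← tab_tab y d, this, tab_tab]

lemma sameCurve_of_isEndpt {C3 : Set (Curve 3)} (hH : SatH C3 2 4)
    {c c' : Curve 3} (hc : c ∈ C3) (hc' : c' ∈ C3) {y : Z3}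
    (hy : IsEven y) {U : Fin 6} (h1 : c.IsEndpt (emb y))
    (h2 : c.IsEndpt (emb (y + (2 : ℤ) • dir U))) (h1' : c'.IsEndpt (emb y))
    (h2' : c'.IsEndpt (emb (y + (2 : ℤ) • dir U))) : SameCurve c c' := by
  obtain ⟨-, -, -, -, -, h, -⟩ := hH
  have key (z i) (hz : IsEven z) := (h (emb z) i (latt_emb z) (inLat_two_iff.2 hz)).2
  simp only [uvec_eq, ← emb_two_smul, ← emb_add] at key
  obtain ⟨i, rfl | rfl⟩ := eq_posDir U
  · exact key y i hy c hc c' hc' h1 h2 h1' h2'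
  · refine key _ i (hy.add (isEven_two_smul (dir (opp (posDir i))))) c hc c' hc' h2 ?_ h2' ?_ <;>
      rwa [dir_opp, smul_neg, neg_add_cancel_right]

lemma endSegAt_iff {C3 : Set (Curve 3)} (hC3 : traceOf C3 = CTrace) (hH : SatH C3 2 4)
    {c : Curve 3} (hc : c ∈ C3) {y : Z3} (hy : IsEven y) {U : Fin 6}
    (h1 : c.IsEndpt (emb y)) (h2 : c.IsEndpt (emb (y + (2 : ℤ) • dir U)))
    {S : Sym2 (Pt 3)} : c.endSegAt (emb y) S ↔ S = seg y (tab y U) := by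
  have hmem : seg y (tab y U) ∈ c.segs := by
    obtain ⟨c', hc', h'⟩ := exists_mem_segs hH (isSeg_seg y (tab y U))
    obtain ⟨h1', h2'⟩ := isEndpt_of_isEven hC3 hH hc' hy h'
    rwa [(sameCurve_of_isEndpt hH hc hc' hy h1 h2 h1' h2').1]
  constructor
  · intro h
    obtain ⟨h3, h4⟩ := mem_segs_of_endSegAt h
    obtain ⟨q, d, rfl⟩ := isSeg_iff.1 (Curve.isSeg_of_mem_segs h3)
    obtain ⟨e, he⟩ : ∃ e, seg q d = seg y e := by
      rw [seg, Sym2.mem_iff, emb_inj, emb_inj] at h4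
      rcases h4 with rfl | rfl
      · exact ⟨d, rfl⟩
      · exact ⟨opp d, (seg_opp q d).symm⟩
    rw [he] at h3 ⊢
    rw [eq_of_seg_mem hC3 hH hc hy h3 hmem]
  · rintro rfl
    exact endSegAt_of_isEven hC3 hc hy hmem

/-! ### The powers of `𝒞` and their limit -/

lemma conn_shared_vertex {a b x : Pt 3} {p : Z3} {d e : Fin 6} (hde : d ≠ e)
    (h1 : s(a, b) = seg p d) (h2 : s(b, x) = seg p e) :
    a = emb (p + dir d) ∧ b = emb p ∧ x = emb (p + dir e) := by
  rcases Sym2.eq_iff.1 h1 with ⟨rfl, rfl⟩ | ⟨rfl, rfl⟩ <;>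
    rcases Sym2.eq_iff.1 h2 with ⟨h, rfl⟩ | ⟨h, rfl⟩
  · simp [dir_ne_zero] at h
  · rw [emb_inj, add_right_inj, dir_injective.eq_iff] at h
    exact absurd h hde
  · exact ⟨rfl, rfl, rfl⟩
  · simp [dir_ne_zero] at h

lemma convTrace_eq {C3 : Set (Curve 3)} (hC3 : traceOf C3 = CTrace) (hH : SatH C3 2 4)
    {B : Set (Curve 3)} {s : ℕ}
    (hB : traceOf B = mkTrace fun p d e => d ≠ e ∧ connPow s p d = e) :
    ConvTrace 2 C3 B = mkTrace fun p d e => d ≠ e ∧ connPow (s + 1) p d = e := by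
  have parentOf {c : Curve 3} (hc : c ∈ C3) {S : Sym2 (Pt 3)} (hS : S ∈ c.segs) :
      ∃ a b : Pt 3, s(a, b) ∈ (traceOf B).segs ∧ c.IsEndpt (((2 : ℕ) : ℝ) • a) ∧
        c.IsEndpt (((2 : ℕ) : ℝ) • b) := by
    obtain ⟨y, d, rfl⟩ := isSeg_iff.1 (Curve.isSeg_of_mem_segs hS)
    obtain ⟨h1, h2⟩ := isEndpt_posn hC3 hH hc hS
    rw [(posn_bounds y d).1.eq_two_smul] at h1 h2
    rw [← smul_add] at h2
    refine ⟨_, _, ?_, emb_two_smul _ ▸ h1, emb_two_smul _ ▸ h2⟩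
    rw [hB]
    exact isSeg_seg _ _
  refine trace_ext (fun S => ⟨?_, fun hS => ?_⟩) (fun S S' => ⟨?_, ?_⟩)
  · rintro ⟨a, b, -, c, -, -, -, hS⟩
    exact Curve.isSeg_of_mem_segs hS
  · obtain ⟨c, hc, hSc⟩ := exists_mem_segs hH hS
    obtain ⟨a, b, hab, h1, h2⟩ := parentOf hc hSc
    exact ⟨a, b, hab, c, hc, h1, h2, hSc⟩
  · rintro (⟨a, b, -, c, hc, -, -, h⟩ | ⟨a, b, x, hab, c, hc, c', hc', h1, h2, h3, h4, h⟩)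
    · obtain ⟨y, d, hy, rfl, rfl⟩ := (exists_conn_iff hC3).1 ⟨c, hc, h⟩
      exact ⟨y, d, tab y d, rfl, rfl, (tab_ne hy d).symm, connPow_of_not_isEven s hy d⟩
    · rw [hB] at hab
      obtain ⟨p, d, e, hd, he, hde, hconn⟩ := hab
      obtain ⟨rfl, rfl, rfl⟩ := conn_shared_vertex hde hd he
      rw [← emb_two_smul, smul_add] at h1 h4
      rw [← emb_two_smul] at h2 h3
      rw [← emb_two_smul, endSegAt_iff hC3 hH hc (isEven_two_smul p) h2 h1,
        endSegAt_iff hC3 hH hc' (isEven_two_smul p) h3 h4,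
        endSegAt_iff hC3 hH hc (isEven_two_smul p) h2 h1,
        endSegAt_iff hC3 hH hc' (isEven_two_smul p) h3 h4] at h
      have hne {d e} (hde : d ≠ e) : tab ((2 : ℤ) • p) d ≠ tab ((2 : ℤ) • p) e := fun h => hde <| by
        rw [← tab_tab ((2 : ℤ) • p) d, h, tab_tab]
      rcases h with ⟨rfl, rfl⟩ | ⟨rfl, rfl⟩
      · exact ⟨_, _, _, rfl, rfl, hne hde, by rw [connPow_two_smul, tab_tab, hconn]⟩
      · exact ⟨_, _, _, rfl, rfl, hne hde.symm,
          by rw [connPow_two_smul, tab_tab, ← hconn, connPow_connPow]⟩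
  · rintro ⟨y, d, e, rfl, rfl, hde, rfl⟩
    by_cases hy : IsEven y
    · obtain ⟨q, rfl⟩ : ∃ q, y = (2 : ℤ) • q := ⟨_, hy.eq_two_smul⟩
      rw [connPow_two_smul] at hde ⊢
      obtain ⟨f, rfl⟩ : ∃ f, d = tab ((2 : ℤ) • q) f := ⟨_, (tab_tab _ d).symm⟩
      rw [tab_tab] at hde ⊢
      obtain ⟨c, hc, hS⟩ := exists_mem_segs hH (isSeg_seg ((2 : ℤ) • q) (tab ((2 : ℤ) • q) f))
      obtain ⟨c', hc', hS'⟩ := exists_mem_segs hH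
        (isSeg_seg ((2 : ℤ) • q) (tab ((2 : ℤ) • q) (connPow s q f)))
      obtain ⟨h1, h2⟩ := isEndpt_of_isEven hC3 hH hc hy hS
      obtain ⟨h3, h4⟩ := isEndpt_of_isEven hC3 hH hc' hy hS'
      rw [← smul_add, emb_two_smul] at h2 h4
      rw [emb_two_smul] at h1 h3
      refine Or.inr ⟨_, _, _, ?_, c, hc, c', hc', h2, h1, h3, h4, Or.inl ⟨?_, ?_⟩⟩
      · rw [hB]
        exact ⟨q, f, connPow s q f, Sym2.eq_swap, rfl, fun h => hde (by rw [← h]), rfl⟩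
      · rw [← emb_two_smul]
        exact endSegAt_of_isEven hC3 hc hy hS
      · rw [← emb_two_smul]
        exact endSegAt_of_isEven hC3 hc' hy hS'
    · rw [connPow_of_not_isEven s hy]
      obtain ⟨c, hc, hconn⟩ := (exists_conn_iff hC3).2 ⟨y, d, hy, rfl, rfl⟩
      obtain ⟨a, b, hab, h1, h2⟩ := parentOf hc (Curve.left_mem_segs_of_conn hconn)
      exact Or.inl ⟨a, b, hab, c, hc, h1, h2, hconn⟩

lemma traceOf_power {C3 : Set (Curve 3)} (hC3 : traceOf C3 = CTrace) (hH : SatH C3 2 4)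
    {P : ℕ → Set (Curve 3)} (hP : PowersOf C3 2 P)
    (s : ℕ) :
    traceOf (P s) = mkTrace fun p d e => d ≠ e ∧ connPow s p d = e := by
  obtain ⟨-, h0, hs⟩ := hP
  induction s with
  | zero =>
    rw [h0]
    refine trace_ext (fun S => Iff.rfl) (fun S S' => ⟨False.elim, ?_⟩)
    rintro ⟨p, d, e, -, -, hde, h⟩
    exact hde h
  | succ s ih => rw [hs, convTrace_eq hC3 hH ih]

lemma hatTrace_eq {C3 : Set (Curve 3)} (hC3 : traceOf C3 = CTrace) (hH : SatH C3 2 4)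
    {P : ℕ → Set (Curve 3)} (hP : PowersOf C3 2 P) :
    hatTrace P = mkTrace fun p d e => ∃ s, d ≠ e ∧ connPow s p d = e := by
  simp only [hatTrace, traceOf_power hC3 hH hP]
  refine trace_ext (fun S => ⟨fun ⟨_, h⟩ => h, fun h => ⟨0, h⟩⟩) (fun S S' => ⟨?_, ?_⟩)
  · rintro ⟨s, p, d, e, h1, h2, h⟩
    exact ⟨p, d, e, h1, h2, s, h⟩
  · rintro ⟨p, d, e, h1, h2, s, h⟩
    exact ⟨s, p, d, e, h1, h2, h⟩

lemma hatRTrace_eq {C3 : Set (Curve 3)} (hC3 : traceOf C3 = CTrace) (hH : SatH C3 2 4)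
    {P : ℕ → Set (Curve 3)} (hP : PowersOf C3 2 P)
    {R : Pt 3 → Pt 3 → Prop} (hR : IsPairing R) :
    hatRTrace P R = mkTrace fun p d e => (∃ s, d ≠ e ∧ connPow s p d = e) ∨
      p = 0 ∧ R (emb (dir d)) (emb (dir e)) := by
  simp only [hatRTrace, hatTrace_eq hC3 hH hP]
  have hseg (d) : seg 0 d = s(0, emb (dir d)) := by rw [seg, emb_zero, zero_add]
  refine trace_ext (fun S => Iff.rfl) (fun S S' => ⟨?_, ?_⟩)
  · rintro (⟨p, d, e, h1, h2, h⟩ | ⟨u, v, h, rfl, rfl⟩)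
    · exact ⟨p, d, e, h1, h2, Or.inl h⟩
    · obtain ⟨hu, hv⟩ := hR.2.1 u v h
      obtain ⟨d, rfl⟩ := isDir_iff.1 hu
      obtain ⟨e, rfl⟩ := isDir_iff.1 hv
      exact ⟨0, d, e, (hseg d).symm, (hseg e).symm, Or.inr ⟨rfl, h⟩⟩
  · rintro ⟨p, d, e, rfl, rfl, h | ⟨rfl, h⟩⟩
    · exact Or.inl ⟨p, d, e, rfl, rfl, h⟩
    · exact Or.inr ⟨_, _, h, hseg d, hseg e⟩

/-! ### A covering by a single curve -/

/-- The oriented segments along the curve. -/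
def track (i : ℤ) : Z3 × Fin 6 := (walk 0 ^ i) (0, 0)

lemma track_add_one (i : ℤ) : track (i + 1) = walk 0 (track i) := by
  rw [track, add_comm, zpow_add, zpow_one, Equiv.Perm.mul_apply, track]

lemma track_add_one_fst (i : ℤ) : (track (i + 1)).1 = (track i).1 + dir (track i).2 := by
  rw [track_add_one, walk_apply]

lemma track_sub_one_fst (i : ℤ) :
    (track (i - 1)).1 = (track i).1 + dir (limConn 0 (track i).1 (track i).2) := by
  have h := track_add_one (i - 1)
  rw [sub_add_cancel] at h
  rw [h, walk_apply, limConn_limConn, add_dir_opp]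

/-- The curve associated with the walk. -/
def limCurve : Curve 3 where
  dom := univ
  ordConn := ordConnected_univ
  nontriv := ⟨0, trivial, trivial⟩
  v i := emb (track i).1
  lattice i _ := latt_emb _
  step i _ _ := by
    obtain ⟨j, hj⟩ := emb_dir (track i).2
    refine ⟨j, ?_⟩
    rw [track_add_one_fst, emb_add]
    rcases hj with hj | hj
    · exact Or.inl (by rw [hj])
    · exact Or.inr (by rw [hj, sub_eq_add_neg])
  noback i _ _ := by
    rw [track_add_one_fst, track_sub_one_fst, ne_eq, emb_inj, add_right_inj,
      dir_injective.eq_iff]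
    exact (limConn_ne _ _).symm

lemma limCurve_seg (i : ℤ) :
    s(limCurve.v i, limCurve.v (i + 1)) = seg (track i).1 (track i).2 := by
  simp only [limCurve, track_add_one_fst, seg]

lemma limCurve_seg_pred (i : ℤ) : s(limCurve.v (i - 1), limCurve.v i) =
    seg (track i).1 (limConn 0 (track i).1 (track i).2) := by
  simp only [limCurve, track_sub_one_fst, seg, Sym2.eq_swap]

lemma selfAvoiding_limCurve : limCurve.SelfAvoiding := by
  intro i j _ _ _ _ h
  rw [limCurve_seg, limCurve_seg, seg_eq_seg] at h
  rcases h with h | h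
  · exact walk_zpow_injective 0 (0, 0) h
  · refine absurd ?_ (walk_zpow_ne_rev (i - j) (track j))
    rw [← Prod.mk.eta (p := rev _), ← h, track, track, ← Equiv.Perm.mul_apply, ← zpow_add,
      sub_add_cancel]

lemma exists_track_eq (p : Z3) (d : Fin 6) : ∃ i, track i = (p, d) ∨ track i = rev (p, d) := by
  rcases sameCycle_or_sameCycle_rev (0, 0) (p, d) with ⟨i, hi⟩ | ⟨i, hi⟩
  exacts [⟨i, Or.inl hi⟩, ⟨i, Or.inr hi⟩]

lemma mem_segs_limCurve {S : Sym2 (Pt 3)} (hS : IsSeg S) : S ∈ limCurve.segs := by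
  obtain ⟨p, d, rfl⟩ := isSeg_iff.1 hS
  obtain ⟨i, hi⟩ := exists_track_eq p d
  refine ⟨i, trivial, trivial, ?_⟩
  rw [limCurve_seg, eq_comm, seg_eq_seg]
  exact hi

lemma isCovering_limCurve : IsCovering {limCurve} := by
  refine ⟨⟨?_, ?_⟩, fun S hS _ => ⟨⟨_, rfl, mem_segs_limCurve hS⟩, ?_⟩⟩
  · rintro c rfl
    exact selfAvoiding_limCurve
  · rintro c rfl d rfl h
    exact absurd ⟨rfl, rfl⟩ h
  · rintro c rfl d rfl _ _
    exact ⟨rfl, rfl⟩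

lemma traceOf_limCurve :
    traceOf {limCurve} = mkTrace fun p d e => d ≠ e ∧ limConn 0 p d = e := by
  refine trace_ext (fun S => ⟨?_, fun hS => ⟨_, rfl, mem_segs_limCurve hS⟩⟩)
    (fun S S' => ⟨?_, ?_⟩)
  · rintro ⟨c, -, hS⟩
    exact Curve.isSeg_of_mem_segs hS
  · rintro ⟨c, rfl, i, -, -, h⟩
    rw [limCurve_seg, limCurve_seg_pred] at h
    rcases h with ⟨rfl, rfl⟩ | ⟨rfl, rfl⟩
    · exact ⟨_, _, _, rfl, rfl, limConn_ne _ _, limConn_limConn _ _ _⟩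
    · exact ⟨_, _, _, rfl, rfl, (limConn_ne _ _).symm, rfl⟩
  · rintro ⟨p, d, e, rfl, rfl, -, rfl⟩
    obtain ⟨i, hi | hi⟩ := exists_track_eq p d
    · refine ⟨_, rfl, i, trivial, trivial, ?_⟩
      rw [limCurve_seg, limCurve_seg_pred, hi]
      exact Or.inr ⟨rfl, rfl⟩
    · have h := track_add_one i
      rw [hi, walk_apply] at h
      simp only [rev, add_dir_opp, opp_opp] at h
      refine ⟨_, rfl, i + 1, trivial, trivial, ?_⟩
      rw [limCurve_seg, limCurve_seg_pred, h, limConn_limConn]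
      exact Or.inl ⟨rfl, rfl⟩

/-! ### Local isomorphism -/

lemma ballIso_mkTrace {f g : Z3 → Fin 6 → Fin 6 → Prop} {x : Pt 3} {r : ℝ} {z : Z3}
    (h : ∀ p, emb p ∈ Metric.closedBall x r → ∀ d e, f p d e ↔ g (p + z) d e) :
    BallIso (mkTrace f) x (mkTrace g) (x + emb z) r := by
  have hball (y : Pt 3) :
      y + emb z ∈ Metric.closedBall (x + emb z) r ↔ y ∈ Metric.closedBall x r := by
    simp [Metric.mem_closedBall, dist_add_right]
  have hmem (p d) : emb p ∈ segPts (seg p d) := ⟨_, _, rfl, 0, le_rfl, zero_le_one, by simp⟩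
  have hpts : ∀ (z : Z3) (y : Pt 3), y ∈ ⋃ S ∈ {S | IsSeg S}, segPts S →
      y + emb z ∈ ⋃ S ∈ {S : Sym2 (Pt 3) | IsSeg S}, segPts S := by
    intro z y hy
    simp only [mem_iUnion, exists_prop] at hy ⊢
    obtain ⟨S, hS, a, b, rfl, t, h0, h1, rfl⟩ := hy
    obtain ⟨p, d, rfl, rfl⟩ := exists_dir_of_isSeg hS
    refine ⟨_, isSeg_seg (p + z) d, _, _, rfl, t, h0, h1, ?_⟩
    simp only [emb_add]
    module
  refine ⟨?_, ?_, ?_⟩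
  · simp only [add_sub_cancel_left]
    ext y
    constructor
    · rintro ⟨y, ⟨h1, h2⟩, rfl⟩
      exact ⟨hpts z y h1, (hball y).2 h2⟩
    · rintro ⟨h1, h2⟩
      refine ⟨y + emb (-z), ⟨hpts _ y h1, ?_⟩, ?_⟩
      · rw [← hball]
        simpa [emb_neg] using h2
      · simp [emb_neg]
  · rintro _ _ ⟨p, d, e, rfl, rfl, hf⟩ hS -
    simp only [add_sub_cancel_left]
    exact ⟨p + z, d, e, map_add_seg _ _ _, map_add_seg _ _ _, (h p (hS (hmem p d)) d e).1 hf⟩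
  · rintro _ _ ⟨p, d, e, rfl, rfl, hg⟩ hS -
    obtain ⟨q, rfl⟩ : ∃ q, p = q + z := ⟨p - z, by abel⟩
    have hq := hS (hmem _ d)
    rw [emb_add, hball] at hq
    have e1 : x - (x + emb z) = emb (-z) := by rw [emb_neg]; abel
    simp only [e1]
    refine ⟨q, d, e, ?_, ?_, (h q hq d e).2 hg⟩ <;> rw [map_add_seg, add_neg_cancel_right]

lemma exists_bound (x : Pt 3) (r : ℝ) : ∃ s : ℕ, ∀ p, emb p ∈ Metric.closedBall x r →
    |p.1| < 2 ^ s ∧ |p.2.1| < 2 ^ s ∧ |p.2.2| < 2 ^ s := by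
  obtain ⟨s, hs⟩ := pow_unbounded_of_one_lt (‖x‖ + r) (one_lt_two (α := ℝ))
  refine ⟨s, fun p hp => ?_⟩
  have hn : ‖emb p‖ ≤ ‖x‖ + r := by
    rw [mem_closedBall_iff_norm] at hp
    linarith [norm_le_norm_add_norm_sub' (emb p) x]
  have key (i : Fin 3) (a : ℤ) (ha : emb p i = a) : |a| < 2 ^ s := by
    have h := PiLp.norm_apply_le (emb p) i
    rw [ha, Real.norm_eq_abs] at h
    have : (|a| : ℝ) < 2 ^ s := by linarith
    exact_mod_cast this
  exact ⟨key 0 _ rfl, key 1 _ rfl, key 2 _ rfl⟩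

lemma finite_emb_mem_closedBall (x : Pt 3) (r : ℝ) :
    {p | emb p ∈ Metric.closedBall x r}.Finite := by
  obtain ⟨s, hs⟩ := exists_bound x r
  refine (Set.finite_Icc ((-2 ^ s, -2 ^ s, -2 ^ s) : Z3) (2 ^ s, 2 ^ s, 2 ^ s)).subset
    fun p hp => ?_
  obtain ⟨h1, h2, h3⟩ := hs p hp
  rw [abs_lt] at h1 h2 h3
  exact ⟨⟨h1.1.le, h2.1.le, h3.1.le⟩, h1.2.le, h2.2.le, h3.2.le⟩

lemma eq_zero_of_abs_lt {s : ℕ} {p q : Z3} (hp : p = (2 ^ s : ℤ) • q)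
    (h : |p.1| < 2 ^ s ∧ |p.2.1| < 2 ^ s ∧ |p.2.2| < 2 ^ s) : p = 0 := by
  subst hp
  obtain ⟨h1, h2, h3⟩ := h
  exact Prod.ext (Int.eq_zero_of_abs_lt_dvd ⟨_, rfl⟩ h1)
    (Prod.ext (Int.eq_zero_of_abs_lt_dvd ⟨_, rfl⟩ h2) (Int.eq_zero_of_abs_lt_dvd ⟨_, rfl⟩ h3))

lemma iterate_tab_zero_conj {q : Z3} (hq : IsEven q) (m k : ℕ) (d : Fin 6) :
    connPow (m + k) ((2 ^ k : ℤ) • q) d = (tab 0)^[k] (connPow m q ((tab 0)^[k] d)) := by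
  induction k generalizing d with
  | zero => simp
  | succ k ih =>
    have e : (2 ^ (k + 1) : ℤ) • q = (2 : ℤ) • (2 ^ k : ℤ) • q := by
      rw [smul_smul]; congr 1; ring
    have h0 : tab ((2 : ℤ) • (2 ^ k : ℤ) • q) = tab 0 := by
      refine tab_congr ?_
      rw [hq.eq_two_smul, smul_comm _ (2 : ℤ), smul_smul, ← zero_add ((2 * 2 : ℤ) • _)]
      exact red_add_four _ _
    rw [e, ← add_assoc, connPow_two_smul, h0, ih, Function.iterate_succ_apply',
      Function.iterate_succ_apply]

lemma theta3_emb_dir (d : Fin 6) : theta3 (emb (dir d)) = emb (dir (tab 0 d)) := by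
  have h0 : tab 0 = ![3, 4, 5, 0, 1, 2] := by decide +kernel
  rw [h0]
  fin_cases d <;> simp [theta3, uvec_eq, ← emb_neg, dir, posDir]

lemma mkTrace_conn_seg {f : Z3 → Fin 6 → Fin 6 → Prop} (hf : ∀ p d e, f p d e → d ≠ e)
    {p : Z3} {d e : Fin 6} : (mkTrace f).conn (seg p d) (seg p e) ↔ f p d e := by
  refine ⟨?_, fun h => ⟨p, d, e, rfl, rfl, h⟩⟩
  rintro ⟨q, d', e', h1, h2, h⟩
  obtain ⟨-, hb, -⟩ := conn_shared_vertex (hf _ _ _ h) (Sym2.eq_swap.trans h1) h2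
  obtain rfl := emb_injective hb
  obtain rfl := seg_left_inj.1 h1
  obtain rfl := seg_left_inj.1 h2
  exact h

lemma rx_iff {C3 : Set (Curve 3)} (hC3 : traceOf C3 = CTrace) (hH : SatH C3 2 4)
    {P : ℕ → Set (Curve 3)} (hP : PowersOf C3 2 P)
    {w : Z3} (hw : ¬ IsEven w) {d e : Fin 6} :
    Rx P (emb ((2 : ℤ) • w)) (emb (dir d)) (emb (dir e)) ↔
      d ≠ e ∧ connPow 2 ((2 : ℤ) • w) d = e := by
  simp only [Rx, ← emb_add]
  rw [hatTrace_eq hC3 hH hP]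
  refine (mkTrace_conn_seg fun p d e ⟨s, h⟩ => h.1).trans
    ⟨fun ⟨s, hde, h⟩ => ⟨hde, ?_⟩, fun h => ⟨2, h⟩⟩
  rw [← h]
  refine connPow_eq_connPow (fun h2 => ?_) (by rw [h]; exact hde.symm)
  obtain ⟨q, hq⟩ := exists_smul_of_connPow_eq h2
  apply hw
  rw [show (2 ^ 2 : ℤ) • q = (2 : ℤ) • (2 : ℤ) • q by rw [smul_smul]; norm_num] at hq
  rw [two_smul_injective hq]
  exact isEven_two_smul q

lemma exists_vector_of_satP {C3 : Set (Curve 3)} (hC3 : traceOf C3 = CTrace) (hH : SatH C3 2 4)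
    {P : ℕ → Set (Curve 3)} (hP : PowersOf C3 2 P)
    {R : Pt 3 → Pt 3 → Prop} (hR : SatP P R) :
    ∃ w : Z3, ¬ IsEven w ∧ ∀ s : ℕ, ∃ k ≥ s, ∀ d e, R (emb (dir d)) (emb (dir e)) ↔
      d ≠ e ∧ connPow (2 + k) ((2 ^ k : ℤ) • (2 : ℤ) • w) d = e := by
  obtain ⟨x, hx, hx', hR⟩ := hR
  have hcoord (i : Fin 3) : ∃ c : ℤ, x i = 2 * c ∧ (c % 2 = 0 → x i = 0 ∨ x i = 4) := by
    rcases hx i with h | h | h | h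
    · exact ⟨-1, by rw [h]; norm_num, by norm_num⟩
    · exact ⟨0, by rw [h]; norm_num, fun _ => Or.inl h⟩
    · exact ⟨1, by rw [h]; norm_num, by norm_num⟩
    · exact ⟨2, by rw [h]; norm_num, fun _ => Or.inr h⟩
  choose c hc hc' using hcoord
  obtain rfl : x = emb ((2 : ℤ) • (c 0, c 1, c 2)) := by
    refine pt3_ext ?_ ?_ ?_ <;>
      simp [emb_apply_zero, emb_apply_one, emb_apply_two, hc]
  have hw : ¬ IsEven (c 0, c 1, c 2) := fun ⟨h0, h1, h2⟩ => hx' fun i => by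
    fin_cases i
    exacts [hc' 0 h0, hc' 1 h1, hc' 2 h2]
  have hinv : Function.Involutive (tab 0) := tab_tab 0
  refine ⟨_, hw, fun s => ?_⟩
  simp only [iterate_tab_zero_conj (isEven_two_smul _)]
  rcases hR with hR | hR
  · refine ⟨2 * s, by omega, fun d e => ?_⟩
    rw [hinv.iterate_even (even_two_mul s), ← hR]
    exact rx_iff hC3 hH hP hw
  · refine ⟨2 * s + 1, by omega, fun d e => ?_⟩
    have h := rx_iff hC3 hH hP hw (d := tab 0 d) (e := tab 0 e)
    rw [hR, Rtheta, theta3_emb_dir, theta3_emb_dir, tab_tab, tab_tab] at h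
    rw [hinv.iterate_odd (odd_two_mul_add_one s), h, hinv.injective.ne_iff, hinv.eq_iff, eq_comm]

lemma locallyIso_limCurve {C3 : Set (Curve 3)} (hC3 : traceOf C3 = CTrace) (hH : SatH C3 2 4)
    {P : ℕ → Set (Curve 3)} (hP : PowersOf C3 2 P)
    {R : Pt 3 → Pt 3 → Prop} (hR : IsPairing R) (hRP : SatP P R) :
    LocallyIso (traceOf {limCurve}) (hatRTrace P R) := by
  rw [traceOf_limCurve, hatRTrace_eq hC3 hH hP hR]
  refine ⟨fun x r _ => ?_, fun x r _ => ?_⟩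
  · obtain ⟨s, hs⟩ := ((finite_emb_mem_closedBall x r).eventually_all.2 fun p _ =>
      Filter.eventually_all.2 fun d => limConn_spec 0 p d).exists
    refine ⟨_, ballIso_mkTrace (z := offset 0 (s + 1)) fun p hp d e => ?_⟩
    have h := hs p hp d
    have hne := limConn_ne p d
    constructor
    · rintro ⟨hde, he⟩
      exact Or.inl ⟨s, hde, h.trans he⟩
    · rintro (⟨s', hde, he⟩ | ⟨h0, -⟩)
      · refine ⟨hde, ?_⟩
        rw [← h] at hne ⊢
        rw [connPow_eq_connPow hne (by rw [he]; exact hde.symm), he]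
      · rw [h0, connPow_zero] at h
        exact absurd h.symm hne
  · obtain ⟨s, hs⟩ := exists_bound x r
    obtain ⟨w, hw, hRw⟩ := exists_vector_of_satP hC3 hH hP hRP
    obtain ⟨k, hk, hRk⟩ := hRw s
    have key {p d e} (hde : d ≠ e)
        (h : connPow (2 + k) (p + (2 ^ k : ℤ) • (2 : ℤ) • w) d = e) :
        limConn 0 (p + ((2 ^ k : ℤ) • (2 : ℤ) • w - offset 0 (2 + k + 1))) d = e := by
      have e' : p + ((2 ^ k : ℤ) • (2 : ℤ) • w - offset 0 (2 + k + 1)) + offset 0 (2 + k + 1)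
          = p + (2 ^ k : ℤ) • (2 : ℤ) • w := by abel
      rw [← e'] at h
      rw [limConn_eq (by rw [h]; exact hde.symm), h]
    refine ⟨_, ballIso_mkTrace
      (z := (2 ^ k : ℤ) • (2 : ℤ) • w - offset 0 (2 + k + 1)) fun p hp d e => ?_⟩
    by_cases hp0 : p = 0
    · subst hp0
      simp only [connPow_zero, true_and]
      have hself : connPow (2 + k) (0 + (2 ^ k : ℤ) • (2 : ℤ) • w) d ≠ d := by
        rw [zero_add]
        intro h
        obtain ⟨v, hv, -⟩ := hR.2.2.2 (emb (dir d)) (isDir_iff.2 ⟨d, rfl⟩)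
        obtain ⟨f, rfl⟩ := isDir_iff.1 (hR.2.1 _ _ hv).2
        obtain ⟨hne, hf⟩ := (hRk d f).1 hv
        exact hne (h.symm.trans hf)
      rw [key hself.symm rfl, hRk, zero_add]
      refine ⟨?_, Or.inr⟩
      rintro (⟨-, hde, h⟩ | h)
      exacts [absurd h hde, h]
    · have hself : connPow s p d ≠ d := fun h => by
        obtain ⟨q, hq⟩ := exists_smul_of_connPow_eq h
        exact hp0 (eq_zero_of_abs_lt hq (hs p hp))
      have hper : connPow (2 + k) (p + (2 ^ k : ℤ) • (2 : ℤ) • w) d = connPow s p d := by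
        have h1 : connPow s (p + (2 ^ k : ℤ) • (2 : ℤ) • w) d = connPow s p d := by
          obtain ⟨m, rfl⟩ := Nat.exists_eq_add_of_le hk
          rw [← connPow_periodic s p ((2 ^ m : ℤ) • w)]
          congr 2
          rw [smul_smul, smul_smul]
          congr 1
          ring
        rw [← h1]
        exact connPow_eq_of_le (by omega) (by rwa [h1])
      rw [key hself.symm hper]
      constructor
      · rintro (⟨s', hde, h⟩ | ⟨h0, -⟩)
        · exact ⟨hde, (connPow_eq_connPow hself (by rw [h]; exact hde.symm)).trans h⟩
        · exact absurd h0 hp0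
      · exact fun h => Or.inl ⟨s, h⟩

/-- Theorem 2.9: there exists a covering of `ℝ³` by a single
self-avoiding curve which is locally isomorphic to the coverings `Ĉ_R` for `R`
satisfying (P). -/
theorem statement16 (C3 : Set (Curve 3)) (hC3 : traceOf C3 = CTrace)
    (hH : SatH C3 2 4) (P : ℕ → Set (Curve 3)) (hP : PowersOf C3 2 P) :
    ∃ E : Set (Curve 3), IsCovering E ∧ (∃ c ∈ E, ∀ d ∈ E, SameCurve d c) ∧
      ∀ R : Pt 3 → Pt 3 → Prop, IsPairing R → SatP P R →
        LocallyIso (traceOf E) (hatRTrace P R) := by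
  exact ⟨{limCurve}, isCovering_limCurve, ⟨limCurve, rfl, fun d hd => hd ▸ ⟨rfl, rfl⟩⟩,
    fun _ hR hRP => locallyIso_limCurve hC3 hH hP hR hRP⟩

end
end Folding
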